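/- Let k be a positive integer, and let d > 0 and θ be real numbers. Then for every integer N ≥ 2, ((k+1)!/(2πi)^{k+1}) · Σ_{1 ≤ |n| ≤ N} ζ(−k + 2πidn) · e^{2πiθn}/n^{k+1} = −d^k · Σ_{0 < h < d log N, h ∈ ℤ} ψ_{k+1}(e^{(h+θ)/d}) + O(log log N), where the implied constant may depend on k, d, and θ. -/

import Mathlib

/-- The `k`-th periodic Bernoulli polynomial: `ψ_k(x) = B_k({x})` for `k ≠ 1`,
and `ψ_1(x) = {x} - 1/2` for non-integer `x`, `ψ_1(x) = 0` for integer `x`. -/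
noncomputable def psiB (k : ℕ) (x : ℝ) : ℝ :=
  if k = 1 then (if Int.fract x = 0 then 0 else Int.fract x - 1 / 2)
  else Polynomial.aeval (Int.fract x) (Polynomial.bernoulli k)

section S1
open MeasureTheory intervalIntegral Set

structure Amp (w w' : ℝ → ℝ) (W a b : ℝ) : Prop where
  d : ∀ x ∈ Icc a b, HasDerivAt w (w' x) x
  c : ContinuousOn w' (Icc a b)
  n : ∀ x ∈ Icc a b, w' x ≤ 0
  p : ∀ x ∈ Icc a b, 0 ≤ w x
  le : ∀ x ∈ Icc a b, w x ≤ W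

structure Phs (Φ Φ' Φ'' : ℝ → ℝ) : Prop where
  d1 : ∀ x, HasDerivAt Φ (Φ' x) x
  d2 : ∀ x, HasDerivAt Φ' (Φ'' x) x
  c : Continuous Φ''
  p : ∀ x, 0 ≤ Φ'' x

lemma Amp.mono {w w' : ℝ → ℝ} {W a b a' b' : ℝ} (h : Amp w w' W a b) (ha : a ≤ a') (hb : b' ≤ b) :
    Amp w w' W a' b' := by
  have hs : Icc a' b' ⊆ Icc a b := Icc_subset_Icc ha hb
  exact ⟨fun x hx => h.d x (hs hx), h.c.mono hs, fun x hx => h.n x (hs hx),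
    fun x hx => h.p x (hs hx), fun x hx => h.le x (hs hx)⟩

lemma amp_one (a b : ℝ) : Amp (fun _ => 1) (fun _ => 0) 1 a b :=
  ⟨fun x _ => hasDerivAt_const x 1, continuousOn_const, fun _ _ => le_rfl, fun _ _ => zero_le_one,
    fun _ _ => le_rfl⟩

lemma vdc1 {a b μ W : ℝ} (hab : a ≤ b) (hμ : 0 < μ) {Φ Φ' Φ'' w w' : ℝ → ℝ}
    (hΦ : Phs Φ Φ' Φ'') (hw : Amp w w' W a b)
    (h : (∀ x ∈ Icc a b, μ ≤ Φ' x) ∨ (∀ x ∈ Icc a b, Φ' x ≤ -μ)) :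
    ‖∫ x in a..b, (w x : ℂ) * Complex.exp (Complex.I * (Φ x : ℂ))‖ ≤ 4 * W / μ := by
  have hne : ∀ x ∈ Icc a b, Φ' x ≠ 0 := by
    intro x hx
    rcases h with h | h
    · have := h x hx; intro h0; linarith
    · have := h x hx; intro h0; linarith
  have habs : ∀ x ∈ Icc a b, μ ≤ |Φ' x| := by
    intro x hx
    rcases h with h | h
    · exact (h x hx).trans (le_abs_self _)
    · have := h x hx; exact (by linarith : μ ≤ -Φ' x).trans (neg_le_abs _)
  have hu : uIcc a b = Icc a b := uIcc_of_le hab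
  have hma : a ∈ Icc a b := ⟨le_rfl, hab⟩
  have hmb : b ∈ Icc a b := ⟨hab, le_rfl⟩
  have hW : 0 ≤ W := (hw.p a hma).trans (hw.le a hma)
  have hΦ'c : Continuous Φ' := continuous_iff_continuousAt.2 fun x => (hΦ.d2 x).continuousAt
  have hΦc : Continuous Φ := continuous_iff_continuousAt.2 fun x => (hΦ.d1 x).continuousAt
  have hwc : ContinuousOn w (Icc a b) := fun x hx => (hw.d x hx).continuousAt.continuousWithinAt
  set F : ℝ → ℝ := fun x => w x / Φ' x with hF
  set F' : ℝ → ℝ := fun x => (w' x * Φ' x - w x * Φ'' x) / (Φ' x) ^ 2 with hF'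
  have hFd : ∀ x ∈ uIcc a b, HasDerivAt (fun x => (F x : ℂ)) ((F' x : ℝ) : ℂ) x := by
    intro x hx
    rw [hu] at hx
    exact ((hw.d x hx).div (hΦ.d2 x) (hne x hx)).ofReal_comp
  have hF'c : ContinuousOn F' (Icc a b) := by
    refine ContinuousOn.div ?_ (by fun_prop) (fun x hx => pow_ne_zero 2 (hne x hx))
    exact (hw.c.mul hΦ'c.continuousOn).sub (hwc.mul hΦ.c.continuousOn)
  have hvd : ∀ x ∈ uIcc a b, HasDerivAt (fun x => -Complex.I * Complex.exp (Complex.I * (Φ x : ℂ)))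
      ((Φ' x : ℂ) * Complex.exp (Complex.I * (Φ x : ℂ))) x := by
    intro x _
    have h1 := ((hΦ.d1 x).ofReal_comp.const_mul Complex.I).cexp.const_mul (-Complex.I)
    refine h1.congr_deriv ?_
    linear_combination (-(Φ' x : ℂ) * Complex.exp (Complex.I * (Φ x : ℂ))) * Complex.I_mul_I
  have hparts := intervalIntegral.integral_mul_deriv_eq_deriv_mul (a := a) (b := b) hFd hvd
    (by
      apply ContinuousOn.intervalIntegrable
      rw [hu]; exact Complex.continuous_ofReal.comp_continuousOn hF'c)
    (by
      apply Continuous.intervalIntegrable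
      fun_prop)
  have heq : ∫ x in a..b, (w x : ℂ) * Complex.exp (Complex.I * (Φ x : ℂ)) =
      ∫ x in a..b, (F x : ℂ) * ((Φ' x : ℂ) * Complex.exp (Complex.I * (Φ x : ℂ))) := by
    apply intervalIntegral.integral_congr
    intro x hx
    rw [hu] at hx
    have := hne x hx
    have h2 : (Φ' x : ℂ) ≠ 0 := by exact_mod_cast this
    simp only [hF]
    push_cast
    field_simp
  have hnv : ∀ x, ‖-Complex.I * Complex.exp (Complex.I * (Φ x : ℂ))‖ = 1 := by
    intro x
    rw [norm_mul, norm_neg, Complex.norm_I, mul_comm Complex.I, Complex.norm_exp_ofReal_mul_I, one_mul]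
  have hFn : ∀ x ∈ Icc a b, ‖(F x : ℂ)‖ ≤ W / μ := by
    intro x hx
    rw [Complex.norm_real, Real.norm_eq_abs, hF, abs_div]
    rw [abs_of_nonneg (hw.p x hx)]
    exact div_le_div₀ hW (hw.le x hx) hμ (habs x hx)
  have hint : ‖∫ x in a..b, ((F' x : ℝ) : ℂ) * (-Complex.I * Complex.exp (Complex.I * (Φ x : ℂ)))‖
      ≤ 2 * W / μ := by
    set g : ℝ → ℝ := fun x => -(w' x) / μ + W * (Φ'' x / (Φ' x) ^ 2) with hg
    have hgc : ContinuousOn g (Icc a b) := by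
      refine (hw.c.neg.div_const _).add (continuousOn_const.mul ?_)
      exact hΦ.c.continuousOn.div (by fun_prop) (fun x hx => pow_ne_zero 2 (hne x hx))
    have hb1 : ‖∫ x in a..b, ((F' x : ℝ) : ℂ) * (-Complex.I * Complex.exp (Complex.I * (Φ x : ℂ)))‖
        ≤ ∫ x in a..b, g x := by
      apply intervalIntegral.norm_integral_le_of_norm_le hab
      · refine Filter.Eventually.of_forall fun x hx => ?_
        have hx : x ∈ Icc a b := Ioc_subset_Icc_self hx
        rw [norm_mul, hnv, mul_one, Complex.norm_real, Real.norm_eq_abs, hF']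
        have e : (w' x * Φ' x - w x * Φ'' x) / (Φ' x) ^ 2 = w' x / Φ' x - w x * (Φ'' x / (Φ' x) ^ 2) := by
          have := hne x hx
          field_simp
        simp only [e]
        refine (abs_sub _ _).trans (add_le_add ?_ ?_)
        · rw [abs_div, abs_of_nonpos (hw.n x hx)]
          exact div_le_div_of_nonneg_left (by linarith [hw.n x hx]) hμ (habs x hx)
        · rw [abs_of_nonneg (mul_nonneg (hw.p x hx) (div_nonneg (hΦ.p x) (sq_nonneg _)))]
          exact mul_le_mul_of_nonneg_right (hw.le x hx) (div_nonneg (hΦ.p x) (sq_nonneg _))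
      · apply ContinuousOn.intervalIntegrable
        rw [hu]; exact hgc
    have hb2 : ∫ x in a..b, g x = (-(w b) / μ - W / Φ' b) - (-(w a) / μ - W / Φ' a) := by
      apply intervalIntegral.integral_eq_sub_of_hasDerivAt (f := fun x => -(w x) / μ - W / Φ' x)
      · intro x hx
        rw [hu] at hx
        have h1 := ((hw.d x hx).neg.div_const μ).sub
          (((hΦ.d2 x).inv (hne x hx)).const_mul W)
        refine HasDerivAt.congr_deriv (f' := -w' x / μ - W * (-Φ'' x / Φ' x ^ 2)) h1 ?_
        show _ = -(w' x) / μ + W * (Φ'' x / (Φ' x) ^ 2)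
        ring
      · apply ContinuousOn.intervalIntegrable
        rw [hu]; exact hgc
    refine hb1.trans (hb2.le.trans ?_)
    have i1 : -(w b) / μ + w a / μ ≤ W / μ := by
      rw [← add_div]
      exact div_le_div_of_nonneg_right (by linarith [hw.p b hmb, hw.le a hma]) hμ.le
    have i2 : W / Φ' a - W / Φ' b ≤ W / μ := by
      rcases h with h | h
      · have := div_le_div_of_nonneg_left hW hμ (h a hma)
        have h3 : 0 ≤ W / Φ' b := div_nonneg hW (hμ.le.trans (h b hmb))
        linarith
      · have h5 := h b hmb
        have := div_le_div_of_nonneg_left hW hμ (by linarith : μ ≤ -Φ' b)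
        have h3 : W / Φ' a ≤ 0 := div_nonpos_of_nonneg_of_nonpos hW (by linarith [h a hma])
        rw [div_neg] at this
        linarith
    have : 2 * W / μ = W / μ + W / μ := by ring
    rw [neg_div (b := w a)]
    linarith
  rw [heq, hparts]
  refine (norm_sub_le _ _).trans ?_
  have h3 := norm_sub_le ((F b : ℂ) * (-Complex.I * Complex.exp (Complex.I * (Φ b : ℂ))))
    ((F a : ℂ) * (-Complex.I * Complex.exp (Complex.I * (Φ a : ℂ))))
  rw [norm_mul (F b : ℂ), norm_mul (F a : ℂ), hnv, hnv, mul_one, mul_one] at h3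
  have h4 := hFn a hma
  have h5 := hFn b hmb
  have : 4 * W / μ = W / μ + W / μ + 2 * W / μ := by ring
  linarith

lemma vdc2 {a b l W : ℝ} (hab : a ≤ b) (hl : 0 < l) {Φ Φ' Φ'' w w' : ℝ → ℝ}
    (hΦ : Phs Φ Φ' Φ'') (hw : Amp w w' W a b)
    (h : ∀ x ∈ Icc a b, l ^ 2 ≤ Φ'' x) :
    ‖∫ x in a..b, (w x : ℂ) * Complex.exp (Complex.I * (Φ x : ℂ))‖ ≤ 10 * W / l := by
  have hma : a ∈ Icc a b := ⟨le_rfl, hab⟩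
  have hW : 0 ≤ W := (hw.p a hma).trans (hw.le a hma)
  have hΦ'c : Continuous Φ' := continuous_iff_continuousAt.2 fun x => (hΦ.d2 x).continuousAt
  have hΦc : Continuous Φ := continuous_iff_continuousAt.2 fun x => (hΦ.d1 x).continuousAt
  have hwc : ContinuousOn w (Icc a b) := fun x hx => (hw.d x hx).continuousAt.continuousWithinAt
  have hmono : Monotone Φ' := monotone_of_hasDerivAt_nonneg hΦ.d2 hΦ.p
  have hgrow : ∀ x ∈ Icc a b, ∀ y ∈ Icc a b, x ≤ y → l ^ 2 * (y - x) ≤ Φ' y - Φ' x := by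
    intro x hx y hy hxy
    apply Convex.mul_sub_le_image_sub_of_le_deriv (convex_Icc a b) hΦ'c.continuousOn
      (fun z _ => (hΦ.d2 z).differentiableAt.differentiableWithinAt) _ x hx y hy hxy
    intro z hz
    rw [(hΦ.d2 z).deriv]
    exact h z (interior_subset hz)
  obtain ⟨y0, hy0, hneg, hpos⟩ : ∃ y0 ∈ Icc a b, (a < y0 → Φ' y0 ≤ 0) ∧ (y0 < b → 0 ≤ Φ' y0) := by
    by_cases h1 : 0 ≤ Φ' a
    · exact ⟨a, hma, fun h => absurd h (lt_irrefl _), fun _ => h1⟩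
    · by_cases h2 : Φ' b ≤ 0
      · exact ⟨b, ⟨hab, le_rfl⟩, fun _ => h2, fun h => absurd h (lt_irrefl _)⟩
      · obtain ⟨y, hy, hy2⟩ := intermediate_value_Icc hab hΦ'c.continuousOn
          (show (0:ℝ) ∈ Icc (Φ' a) (Φ' b) from ⟨by linarith, by linarith⟩)
        exact ⟨y, hy, fun _ => hy2.le, fun _ => hy2.ge⟩
  have hin : ∀ u v, a ≤ u → v ≤ b → u ≤ v →
      IntervalIntegrable (fun x => (w x : ℂ) * Complex.exp (Complex.I * (Φ x : ℂ))) volume u v := by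
    intro u v hu hv huv
    apply ContinuousOn.intervalIntegrable
    rw [uIcc_of_le huv]
    refine ((Complex.continuous_ofReal.comp_continuousOn hwc).mono (Icc_subset_Icc hu hv)).mul ?_
    fun_prop
  set y1 := max a (y0 - 1 / l) with hy1
  set y2 := min b (y0 + 1 / l) with hy2
  have hl' : 0 < 1 / l := by positivity
  have a1 : a ≤ y1 := le_max_left _ _
  have b2 : y2 ≤ b := min_le_left _ _
  have y10 : y1 ≤ y0 := max_le hy0.1 (by linarith)
  have y02 : y0 ≤ y2 := le_min hy0.2 (by linarith)
  have y12 : y1 ≤ y2 := y10.trans y02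
  have hll : l ^ 2 * (1 / l) = l := by field_simp
  have I1 : ‖∫ x in a..y1, (w x : ℂ) * Complex.exp (Complex.I * (Φ x : ℂ))‖ ≤ 4 * W / l := by
    rcases a1.eq_or_lt with e | e
    · rw [← e]; simp; positivity
    · have e1 : y1 = y0 - 1 / l := by
        rcases max_choice a (y0 - 1 / l) with h | h
        · exact absurd (hy1.trans h) e.ne'
        · exact h
      refine vdc1 a1 hl hΦ (hw.mono le_rfl (y10.trans hy0.2)) (Or.inr fun x hx => ?_)
      have g := hgrow x ⟨hx.1, hx.2.trans (y10.trans hy0.2)⟩ y0 hy0 (hx.2.trans y10)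
      have := hneg (e.trans_le y10)
      have h3 : l ^ 2 * (1 / l) ≤ l ^ 2 * (y0 - x) :=
        mul_le_mul_of_nonneg_left (by linarith [hx.2]) (by positivity)
      linarith
  have I3 : ‖∫ x in y2..b, (w x : ℂ) * Complex.exp (Complex.I * (Φ x : ℂ))‖ ≤ 4 * W / l := by
    rcases b2.eq_or_lt with e | e
    · rw [e]; simp; positivity
    · have e1 : y2 = y0 + 1 / l := by
        rcases min_choice b (y0 + 1 / l) with h | h
        · exact absurd (hy2.trans h) e.ne
        · exact h
      refine vdc1 b2 hl hΦ (hw.mono (hy0.1.trans y02) le_rfl) (Or.inl fun x hx => ?_)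
      have g := hgrow y0 hy0 x ⟨hy0.1.trans (y02.trans hx.1), hx.2⟩ (y02.trans hx.1)
      have := hpos (y02.trans_lt e)
      have h3 : l ^ 2 * (1 / l) ≤ l ^ 2 * (x - y0) :=
        mul_le_mul_of_nonneg_left (by linarith [hx.1]) (by positivity)
      linarith
  have I2 : ‖∫ x in y1..y2, (w x : ℂ) * Complex.exp (Complex.I * (Φ x : ℂ))‖ ≤ 2 * W / l := by
    have := intervalIntegral.norm_integral_le_of_norm_le_const (a := y1) (b := y2) (C := W)
      (f := fun x => (w x : ℂ) * Complex.exp (Complex.I * (Φ x : ℂ))) (by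
        intro x hx
        rw [uIoc_of_le y12] at hx
        have hx' : x ∈ Icc a b := ⟨a1.trans hx.1.le, hx.2.trans b2⟩
        rw [norm_mul, mul_comm Complex.I, Complex.norm_exp_ofReal_mul_I, mul_one, Complex.norm_real,
          Real.norm_eq_abs, abs_of_nonneg (hw.p x hx')]
        exact hw.le x hx')
    refine this.trans ?_
    rw [abs_of_nonneg (by linarith)]
    have h3 : y2 - y1 ≤ 2 / l := by
      have := le_max_right a (y0 - 1 / l)
      have := min_le_right b (y0 + 1 / l)
      have : 2 / l = 1 / l + 1 / l := by ring
      linarith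
    calc W * (y2 - y1) ≤ W * (2 / l) := mul_le_mul_of_nonneg_left h3 hW
      _ = _ := by ring
  rw [← intervalIntegral.integral_add_adjacent_intervals (hin a y1 le_rfl (y12.trans b2) a1)
    (hin y1 b a1 le_rfl (y12.trans b2)),
    ← intervalIntegral.integral_add_adjacent_intervals (hin y1 y2 a1 b2 y12)
    (hin y2 b (a1.trans y12) le_rfl b2)]
  refine (norm_add_le _ _).trans ((add_le_add I1 ((norm_add_le _ _).trans (add_le_add I2 I3))).trans ?_)
  apply le_of_eq; ring

end S1

section S2
open MeasureTheory intervalIntegral Set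

noncomputable def dk (N : ℕ) (y : ℝ) : ℝ :=
  1 + ∑ n ∈ Finset.range N, 2 * Real.cos (2 * Real.pi * (n + 1) * y)

lemma dk_mul_sin (N : ℕ) (y : ℝ) :
    dk N y * Real.sin (Real.pi * y) = Real.sin ((2 * N + 1) * Real.pi * y) := by
  induction N with
  | zero => simp [dk]
  | succ n ih =>
    have : dk (n + 1) y = dk n y + 2 * Real.cos (2 * Real.pi * (n + 1) * y) := by
      simp only [dk, Finset.sum_range_succ]; ring
    rw [this, add_mul, ih]
    have e1 : (2 * (n : ℝ) + 1) * Real.pi * y = 2 * Real.pi * (n + 1) * y - Real.pi * y := by ring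
    have e2 : (2 * ((n + 1 : ℕ) : ℝ) + 1) * Real.pi * y = 2 * Real.pi * (n + 1) * y + Real.pi * y := by
      push_cast; ring
    rw [e1, e2, Real.sin_sub, Real.sin_add]; ring

lemma dk_cont (N : ℕ) : Continuous (dk N) := by
  unfold dk; fun_prop

lemma dk_even (N : ℕ) (y : ℝ) : dk N (-y) = dk N y := by
  simp only [dk, mul_neg, Real.cos_neg]

lemma dk_add_int (N : ℕ) (y : ℝ) (h : ℤ) : dk N (y + h) = dk N y := by
  simp only [dk]
  congr 1
  refine Finset.sum_congr rfl fun n _ => ?_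
  congr 1
  rw [← Real.cos_add_int_mul_two_pi (2 * Real.pi * (n + 1) * y) ((n + 1) * h)]
  congr 1; push_cast; ring

lemma dk_integral (N : ℕ) : ∫ y in (0:ℝ)..(1/2), dk N y = 1 / 2 := by
  unfold dk
  rw [intervalIntegral.integral_add (by simp) (by apply Continuous.intervalIntegrable; fun_prop),
    intervalIntegral.integral_finsetSum (fun i _ => by apply Continuous.intervalIntegrable; fun_prop)]
  rw [Finset.sum_eq_zero]
  · simp
  · intro n _
    rw [intervalIntegral.integral_const_mul, intervalIntegral.integral_comp_mul_left _ (by positivity)]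
    have : Real.sin (2 * Real.pi * (n + 1) * (1 / 2)) = 0 := by
      rw [← Real.sin_nat_mul_pi (n + 1)]; congr 1; push_cast; ring
    rw [integral_cos, this]; simp

lemma dk_bound (N : ℕ) (y : ℝ) : |dk N y| ≤ 2 * N + 1 := by
  unfold dk
  refine (abs_add_le _ _).trans ?_
  have : |∑ n ∈ Finset.range N, 2 * Real.cos (2 * Real.pi * (n + 1) * y)| ≤ ∑ n ∈ Finset.range N, (2:ℝ) := by
    refine (Finset.abs_sum_le_sum_abs _ _).trans (Finset.sum_le_sum fun n _ => ?_)
    rw [abs_mul, abs_two]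
    have := Real.abs_cos_le_one (2 * Real.pi * (n + 1) * y)
    linarith
  simp at this ⊢
  linarith

lemma two_mul_le_sin {y : ℝ} (h0 : 0 ≤ y) (h1 : y ≤ 1 / 2) : 2 * y ≤ Real.sin (Real.pi * y) := by
  have := Real.mul_le_sin (x := Real.pi * y) (by positivity) (by nlinarith [Real.pi_pos])
  have e : 2 / Real.pi * (Real.pi * y) = 2 * y := by field_simp
  linarith

lemma sin_pos' {y : ℝ} (h0 : 0 < y) (h1 : y ≤ 1 / 2) : 0 < Real.sin (Real.pi * y) :=
  lt_of_lt_of_le (by linarith) (two_mul_le_sin h0.le h1)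

lemma dk_eq (N : ℕ) {y : ℝ} (h0 : 0 < y) (h1 : y ≤ 1 / 2) :
    dk N y = (1 / Real.sin (Real.pi * y)) * Real.sin ((2 * N + 1) * Real.pi * y) := by
  have := (sin_pos' h0 h1).ne'
  rw [← dk_mul_sin]; field_simp

lemma amp_sin {u v : ℝ} (hu : 0 < u) (hv : v ≤ 1 / 2) :
    Amp (fun y => 1 / Real.sin (Real.pi * y))
      (fun y => -(Real.pi * Real.cos (Real.pi * y)) / (Real.sin (Real.pi * y)) ^ 2) (1 / (2 * u)) u v := by
  have hpos : ∀ x ∈ Icc u v, 0 < Real.sin (Real.pi * x) := fun x hx =>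
    sin_pos' (hu.trans_le hx.1) (hx.2.trans hv)
  refine ⟨fun x hx => ?_, ?_, fun x hx => ?_, fun x hx => ?_, fun x hx => ?_⟩
  · have h1 : HasDerivAt (fun y : ℝ => Real.sin (Real.pi * y)) (Real.cos (Real.pi * x) * (Real.pi * 1)) x :=
      ((hasDerivAt_id x).const_mul Real.pi).sin
    have h2 := h1.inv (hpos x hx).ne'
    simp only [one_div]
    refine h2.congr_deriv ?_
    ring
  · refine ContinuousOn.div (by fun_prop) (by fun_prop) (fun x hx => pow_ne_zero 2 (hpos x hx).ne')
  · apply div_nonpos_of_nonpos_of_nonneg _ (sq_nonneg _)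
    have : 0 ≤ Real.cos (Real.pi * x) := by
      apply Real.cos_nonneg_of_mem_Icc
      have := hx.1; have := hx.2
      constructor <;> nlinarith [Real.pi_pos]
    have := mul_nonneg Real.pi_pos.le this
    linarith
  · exact one_div_nonneg.2 (hpos x hx).le
  · apply one_div_le_one_div_of_le (by positivity)
    have := two_mul_le_sin (hu.trans_le hx.1).le (hx.2.trans hv)
    linarith [hx.1]

lemma phs_exp {L : ℝ} (hL : 0 ≤ L) (r c : ℝ) :
    Phs (fun y => L * Real.exp (r * y) + c * y) (fun y => L * r * Real.exp (r * y) + c)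
      (fun y => L * r ^ 2 * Real.exp (r * y)) := by
  have he : ∀ x, HasDerivAt (fun y => Real.exp (r * y)) (Real.exp (r * x) * (r * 1)) x :=
    fun x => ((hasDerivAt_id x).const_mul r).exp
  refine ⟨fun x => ?_, fun x => ?_, by fun_prop, fun x => by positivity⟩
  · refine (((he x).const_mul L).add ((hasDerivAt_id x).const_mul c)).congr_deriv ?_
    ring
  · refine (((he x).const_mul (L * r)).add_const c).congr_deriv ?_
    ring

lemma si_tail {c u v : ℝ} (hc : 0 < c) (hu : 0 < u) (huv : u ≤ v) (hv : v ≤ 1 / 2) :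
    |∫ y in u..v, (1 / Real.sin (Real.pi * y)) * Real.sin (c * y)| ≤ 2 / (u * c) := by
  have h := vdc1 huv hc (phs_exp le_rfl 0 c) (amp_sin hu hv) (Or.inl fun x _ => by simp)
  have hii : IntervalIntegrable (fun y : ℝ => ((1 / Real.sin (Real.pi * y) : ℝ) : ℂ) *
      Complex.exp (Complex.I * ((0 * Real.exp (0 * y) + c * y : ℝ) : ℂ))) volume u v := by
    apply ContinuousOn.intervalIntegrable
    rw [uIcc_of_le huv]
    refine (Complex.continuous_ofReal.comp_continuousOn ?_).mul (by fun_prop)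
    intro x hx
    exact ((amp_sin hu hv).d x hx).continuousAt.continuousWithinAt
  have e : ∫ y in u..v, (1 / Real.sin (Real.pi * y)) * Real.sin (c * y) =
      (∫ y in u..v, ((1 / Real.sin (Real.pi * y) : ℝ) : ℂ) *
      Complex.exp (Complex.I * ((0 * Real.exp (0 * y) + c * y : ℝ) : ℂ))).im := by
    have := Complex.imCLM.intervalIntegral_comp_comm hii
    simp only [Complex.imCLM_apply] at this
    rw [← this]
    apply intervalIntegral.integral_congr
    intro y _
    simp only [Complex.im_ofReal_mul]
    rw [mul_comm Complex.I, Complex.exp_ofReal_mul_I_im]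
    simp
  rw [e]
  refine (Complex.abs_im_le_norm _).trans (h.trans (le_of_eq ?_))
  field_simp; norm_num

lemma si_bdd (c : ℝ) {y : ℝ} (hu : 0 < y) (hv : y ≤ 1 / 2) :
    |(1 / Real.sin (Real.pi * y)) * Real.sin (c * y)| ≤ |c| / 2 := by
  have h1 := two_mul_le_sin hu.le hv
  have h2 := sin_pos' hu hv
  rw [abs_mul, abs_of_pos (one_div_pos.2 h2), one_div, inv_mul_le_iff₀ h2]
  have : |Real.sin (c * y)| ≤ |c * y| := Real.abs_sin_le_abs
  rw [abs_mul, abs_of_pos hu] at this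
  nlinarith [abs_nonneg c]

lemma si_int (c : ℝ) {u v : ℝ} (hu : 0 ≤ u) (huv : u ≤ v) (hv : v ≤ 1 / 2) : IntervalIntegrable
    (fun y => (1 / Real.sin (Real.pi * y)) * Real.sin (c * y)) volume u v := by
  rw [intervalIntegrable_iff_integrableOn_Ioc_of_le huv]
  refine Measure.integrableOn_of_bounded (M := |c| / 2) (by simp) ?_ ?_
  · apply Measurable.aestronglyMeasurable
    fun_prop
  · rw [ae_restrict_iff' measurableSet_Ioc]
    refine Filter.Eventually.of_forall fun y hy => ?_
    exact si_bdd c (hu.trans_lt hy.1) (hy.2.trans hv)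

lemma si_full_pos {c v : ℝ} (hc : 0 < c) (h0 : 0 ≤ v) (hv : v ≤ 1 / 2) :
    |∫ y in (0:ℝ)..v, (1 / Real.sin (Real.pi * y)) * Real.sin (c * y)| ≤ 3 := by
  have small : ∀ u, 0 ≤ u → u ≤ v → u ≤ 1 / c →
      |∫ y in (0:ℝ)..u, (1 / Real.sin (Real.pi * y)) * Real.sin (c * y)| ≤ 1 := by
    intro u hu huv huc
    have := intervalIntegral.norm_integral_le_of_norm_le_const (a := 0) (b := u) (C := c / 2)
      (f := fun y => (1 / Real.sin (Real.pi * y)) * Real.sin (c * y)) (by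
        intro y hy
        rw [uIoc_of_le hu] at hy
        have := si_bdd c hy.1 (hy.2.trans (huv.trans hv))
        rwa [abs_of_pos hc] at this)
    rw [Real.norm_eq_abs] at this
    refine this.trans ?_
    rw [sub_zero, abs_of_nonneg hu]
    calc c / 2 * u ≤ c / 2 * (1 / c) := by gcongr
      _ = 1 / 2 := by field_simp
      _ ≤ 1 := by norm_num
  rcases le_total v (1 / c) with h | h
  · exact (small v h0 le_rfl h).trans (by norm_num)
  · have hc' : 0 < 1 / c := by positivity
    rw [← intervalIntegral.integral_add_adjacent_intervals (si_int c le_rfl hc'.le (h.trans hv))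
      (si_int c hc'.le h hv)]
    have h1 := small (1 / c) hc'.le h le_rfl
    have h2 := si_tail hc hc' h hv
    have e : 2 / (1 / c * c) = 2 := by field_simp
    rw [e] at h2
    exact (abs_add_le _ _).trans (by linarith)

lemma si_full (c : ℝ) {v : ℝ} (h0 : 0 ≤ v) (hv : v ≤ 1 / 2) :
    |∫ y in (0:ℝ)..v, (1 / Real.sin (Real.pi * y)) * Real.sin (c * y)| ≤ 3 := by
  rcases lt_trichotomy c 0 with h | h | h
  · have := si_full_pos (neg_pos.2 h) h0 hv
    simp only [neg_mul, Real.sin_neg, mul_neg, intervalIntegral.integral_neg, abs_neg] at this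
    exact this
  · subst h; simp
  · exact si_full_pos h h0 hv

end S2

section S3
open MeasureTheory intervalIntegral Set

lemma dk_prim_bdd (N : ℕ) {u : ℝ} (h0 : 0 ≤ u) (hv : u ≤ 1 / 2) :
    |∫ y in (0:ℝ)..u, dk N y| ≤ 3 := by
  have := si_full ((2 * N + 1) * Real.pi) h0 hv
  rw [intervalIntegral.integral_congr_ae (g := fun y => (1 / Real.sin (Real.pi * y)) *
    Real.sin ((2 * N + 1) * Real.pi * y))]
  · exact this
  · refine Filter.Eventually.of_forall fun y hy => ?_
    rw [uIoc_of_le h0] at hy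
    exact dk_eq N hy.1 (hy.2.trans hv)

lemma dk_tail (N : ℕ) (hN : 0 < N) {u : ℝ} (h0 : 0 < u) (hv : u ≤ 1 / 2) :
    |∫ y in u..(1/2), dk N y| ≤ 1 / (N * u) := by
  have hN' : (0:ℝ) < N := by exact_mod_cast hN
  have hp := Real.pi_gt_three
  have := si_tail (c := (2 * N + 1) * Real.pi) (by positivity) h0 hv le_rfl
  rw [intervalIntegral.integral_congr (g := fun y => (1 / Real.sin (Real.pi * y)) *
    Real.sin ((2 * N + 1) * Real.pi * y))]
  · refine this.trans ?_
    rw [div_le_div_iff₀ (by positivity) (by positivity)]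
    have : (2 * (N:ℝ) + 1) * Real.pi ≥ 2 * N := by nlinarith
    nlinarith
  · intro y hy
    rw [uIcc_of_le hv] at hy
    exact dk_eq N (h0.trans_le hy.1) hy.2

lemma smooth_half (N : ℕ) (hN : 3 ≤ N) {F F' : ℝ → ℂ} (hF : ∀ y, HasDerivAt F (F' y) y)
    (hc : Continuous F') {K : ℝ} (hK : ∀ y ∈ Icc (0:ℝ) (1/2), ‖F' y‖ ≤ K) :
    ‖(∫ y in (0:ℝ)..(1/2), F y * (dk N y : ℂ)) - F 0 / 2‖ ≤ 5 * K * (Real.log N / N) := by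
  have hN' : (3:ℝ) ≤ N := by exact_mod_cast hN
  have hN0 : (0:ℝ) < N := by linarith
  have hK0 : 0 ≤ K := (norm_nonneg _).trans (hK 0 (by norm_num))
  have hlog : 1 ≤ Real.log N := by
    rw [Real.le_log_iff_exp_le hN0]
    exact Real.exp_one_lt_three.le.trans hN'
  have hdc := dk_cont N
  have hFc : Continuous F := continuous_iff_continuousAt.2 fun x => (hF x).continuousAt
  set v : ℝ → ℝ := fun y => (∫ t in (0:ℝ)..y, dk N t) - 1 / 2 with hv
  have hvd : ∀ y, HasDerivAt v (dk N y) y := fun y =>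
    (intervalIntegral.integral_hasDerivAt_right (hdc.intervalIntegrable _ _)
      hdc.aestronglyMeasurable.stronglyMeasurableAtFilter hdc.continuousAt).sub_const _
  have hvc : Continuous v := continuous_iff_continuousAt.2 fun x => (hvd x).continuousAt
  have hv1 : v (1 / 2) = 0 := by simp only [hv, dk_integral]; norm_num
  have hvt : ∀ y, v y = - ∫ t in y..(1/2), dk N t := by
    intro y
    have := intervalIntegral.integral_add_adjacent_intervals (hdc.intervalIntegrable (μ := volume) 0 y)
      (hdc.intervalIntegrable y (1/2))
    rw [dk_integral] at this
    simp only [hv]; linarith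
  have hparts := intervalIntegral.integral_mul_deriv_eq_deriv_mul (a := 0) (b := 1/2)
    (u := fun y => F y - F 0) (u' := F') (v := fun y => (v y : ℂ)) (v' := fun y => (dk N y : ℂ))
    (fun y _ => (hF y).sub_const _) (fun y _ => (hvd y).ofReal_comp)
    (hc.intervalIntegrable _ _) ((Complex.continuous_ofReal.comp hdc).intervalIntegrable _ _)
  have e1 : (∫ y in (0:ℝ)..(1/2), F y * (dk N y : ℂ)) - F 0 / 2 =
      ∫ y in (0:ℝ)..(1/2), (F y - F 0) * (dk N y : ℂ) := by
    have : ∫ y in (0:ℝ)..(1/2), (F y - F 0) * (dk N y : ℂ) =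
      (∫ y in (0:ℝ)..(1/2), F y * (dk N y : ℂ)) - ∫ y in (0:ℝ)..(1/2), F 0 * (dk N y : ℂ) := by
      rw [← intervalIntegral.integral_sub]
      · simp only [sub_mul]
      · apply Continuous.intervalIntegrable; fun_prop
      · apply Continuous.intervalIntegrable; fun_prop
    rw [this, intervalIntegral.integral_const_mul, intervalIntegral.integral_ofReal, dk_integral]
    push_cast; ring
  rw [e1, hparts, hv1]
  simp only [sub_self, zero_mul, Complex.ofReal_zero, mul_zero, zero_sub, norm_neg]
  have hcont : Continuous (fun y => F' y * (v y : ℂ)) := by fun_prop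
  have hNN : 1 / (N:ℝ) ≤ 1 / 2 := one_div_le_one_div_of_le (by norm_num) (by linarith)
  have hNp : 0 < 1 / (N:ℝ) := by positivity
  rw [← intervalIntegral.integral_add_adjacent_intervals (hcont.intervalIntegrable 0 (1 / N))
    (hcont.intervalIntegrable (1 / N) (1 / 2))]
  have b1 : ‖∫ y in (0:ℝ)..(1 / N), F' y * (v y : ℂ)‖ ≤ K * 4 * (1 / N) := by
    have := intervalIntegral.norm_integral_le_of_norm_le_const (a := 0) (b := 1 / N) (C := K * 4)
      (f := fun y => F' y * (v y : ℂ)) (by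
        intro y hy
        rw [uIoc_of_le hNp.le] at hy
        rw [norm_mul]
        refine mul_le_mul (hK y ⟨hy.1.le, hy.2.trans hNN⟩) ?_ (norm_nonneg _) hK0
        rw [Complex.norm_real, Real.norm_eq_abs]
        have := dk_prim_bdd N hy.1.le (hy.2.trans hNN)
        simp only [hv]
        refine (abs_sub _ _).trans ?_
        rw [abs_of_pos (by norm_num : (0:ℝ) < 1/2)]
        linarith)
    rwa [sub_zero, abs_of_pos hNp] at this
  have b2 : ‖∫ y in (1 / N : ℝ)..(1 / 2), F' y * (v y : ℂ)‖ ≤ K * (1 / N) * Real.log N := by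
    have := intervalIntegral.norm_integral_le_of_norm_le (a := 1 / N) (b := 1 / 2) (μ := volume)
      (f := fun y => F' y * (v y : ℂ)) (g := fun y => K * (1 / N) * (1 / y)) hNN (by
        refine Filter.Eventually.of_forall fun y hy => ?_
        have hy0 : 0 < y := hNp.trans hy.1
        rw [norm_mul, mul_assoc]
        refine mul_le_mul (hK y ⟨hy0.le, hy.2⟩) ?_ (norm_nonneg _) hK0
        rw [Complex.norm_real, Real.norm_eq_abs, hvt, abs_neg]
        refine (dk_tail N (by omega) hy0 hy.2).trans (le_of_eq ?_)
        field_simp) (by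
        apply ContinuousOn.intervalIntegrable
        rw [uIcc_of_le hNN]
        refine continuousOn_const.mul (continuousOn_const.div continuousOn_id ?_)
        intro y hy; exact (hNp.trans_le hy.1).ne')
    refine this.trans ?_
    rw [intervalIntegral.integral_const_mul, integral_one_div_of_pos hNp (by norm_num)]
    refine mul_le_mul_of_nonneg_left ?_ (by positivity)
    apply Real.log_le_log (by positivity)
    rw [div_le_iff₀ hNp]; field_simp; norm_num
  refine (norm_add_le _ _).trans ((add_le_add b1 b2).trans ?_)
  have : 5 * K * (Real.log N / N) = K * 4 * (1/N) * Real.log N + K * (1 / N) * Real.log N := by ring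
  rw [this]
  exact add_le_add (le_mul_of_one_le_right (by positivity) hlog) le_rfl

noncomputable def ef (L r y : ℝ) : ℂ := Complex.exp (Complex.I * ((L * Real.exp (r * y) : ℝ) : ℂ))

lemma ef_cont (L r : ℝ) : Continuous (ef L r) := by unfold ef; fun_prop

lemma ef_norm (L r y : ℝ) : ‖ef L r y‖ = 1 := by
  unfold ef; rw [mul_comm Complex.I, Complex.norm_exp_ofReal_mul_I]

lemma ef_deriv (L r y : ℝ) : HasDerivAt (ef L r)
    (ef L r y * (Complex.I * ((L * r * Real.exp (r * y) : ℝ) : ℂ))) y := by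
  have he : HasDerivAt (fun y => L * Real.exp (r * y)) (L * (Real.exp (r * y) * (r * 1))) y :=
    ((hasDerivAt_id y).const_mul r).exp.const_mul L
  have := (he.ofReal_comp.const_mul Complex.I).cexp
  refine this.congr_deriv ?_
  unfold ef
  congr 3; ring

lemma exp_bd {d y r : ℝ} (hd : 0 < d) (hr : |r| = 1 / d) (hy : y ∈ Icc (0:ℝ) (1/2)) :
    Real.exp (r * y) ≤ Real.exp (1 / (2 * d)) ∧ Real.exp (-(1 / (2 * d))) ≤ Real.exp (r * y) := by
  have h1 : |r * y| ≤ 1 / (2 * d) := by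
    rw [abs_mul, hr, abs_of_nonneg hy.1]
    calc 1 / d * y ≤ 1 / d * (1/2) := by gcongr; exact hy.2
      _ = _ := by field_simp
  rw [Real.exp_le_exp, Real.exp_le_exp]
  exact ⟨(abs_le.1 h1).2, (abs_le.1 h1).1⟩

lemma half_ii (N : ℕ) (hN : 3 ≤ N) {d L r : ℝ} (hd : 0 < d) (hL : 0 ≤ L) (hr : |r| = 1 / d) :
    ‖(∫ y in (0:ℝ)..(1/2), ef L r y * (dk N y : ℂ)) - Complex.exp (Complex.I * L) / 2‖
      ≤ 5 * (L * (1 / d) * Real.exp (1 / (2 * d))) * (Real.log N / N) := by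
  have h0 : ef L r 0 = Complex.exp (Complex.I * L) := by simp [ef]
  rw [← h0]
  refine smooth_half N hN (ef_deriv L r) ?_ ?_
  · have := ef_cont L r
    fun_prop
  · intro y hy
    rw [norm_mul, ef_norm, one_mul, norm_mul, Complex.norm_I, one_mul, Complex.norm_real,
      Real.norm_eq_abs, abs_mul, abs_mul, hr, abs_of_nonneg hL, Real.abs_exp]
    gcongr
    have := (exp_bd hd hr hy).1
    simpa using this

noncomputable def cellE (N : ℕ) (L d : ℝ) : ℂ :=
  ∫ y in (0:ℝ)..(1/2), (ef L (1 / d) y + ef L (-(1 / d)) y) * (dk N y : ℂ)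

lemma efdk_int (N : ℕ) (L r a b : ℝ) : IntervalIntegrable (fun y => ef L r y * (dk N y : ℂ)) volume a b := by
  have h1 := ef_cont L r
  have h2 := dk_cont N
  apply Continuous.intervalIntegrable
  fun_prop

lemma cell_ii {d : ℝ} (hd : 0 < d) : ∃ C > 0, ∀ N : ℕ, 3 ≤ N → ∀ L : ℝ, 0 ≤ L →
    ‖cellE N L d - Complex.exp (Complex.I * L)‖ ≤ C * (L * (Real.log N / N)) := by
  refine ⟨10 * ((1 / d) * Real.exp (1 / (2 * d))), by positivity, fun N hN L hL => ?_⟩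
  have h1 := half_ii N hN hd hL (r := 1 / d) (abs_of_pos (by positivity))
  have h2 := half_ii N hN hd hL (r := -(1 / d)) (by rw [abs_neg]; exact abs_of_pos (by positivity))
  have e : cellE N L d - Complex.exp (Complex.I * L) =
    ((∫ y in (0:ℝ)..(1/2), ef L (1/d) y * (dk N y : ℂ)) - Complex.exp (Complex.I * L) / 2) +
    ((∫ y in (0:ℝ)..(1/2), ef L (-(1/d)) y * (dk N y : ℂ)) - Complex.exp (Complex.I * L) / 2) := by
    unfold cellE
    simp only [add_mul]
    rw [intervalIntegral.integral_add (efdk_int _ _ _ _ _) (efdk_int _ _ _ _ _)]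
    ring
  rw [e]
  refine (norm_add_le _ _).trans ((add_le_add h1 h2).trans (le_of_eq ?_))
  ring

lemma outer_bd (N : ℕ) {d L r δ : ℝ} (hd : 0 < d) (hL : 1 ≤ L) (hr : |r| = 1 / d)
    (hδ : 0 < δ) (hδ2 : δ ≤ 1 / 2) :
    ‖∫ y in δ..(1/2), ef L r y * (dk N y : ℂ)‖ ≤
      10 * (1 / (2 * δ)) / (Real.sqrt L * (Real.exp (-(1 / (4 * d))) / d)) := by
  set M : ℝ := (2 * N + 1) * Real.pi with hM
  have hLp : 0 < L := by linarith
  have key : ∀ c : ℝ, ‖∫ y in δ..(1/2), ((1 / Real.sin (Real.pi * y) : ℝ) : ℂ) *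
      Complex.exp (Complex.I * ((L * Real.exp (r * y) + c * y : ℝ) : ℂ))‖ ≤
      10 * (1 / (2 * δ)) / (Real.sqrt L * (Real.exp (-(1 / (4 * d))) / d)) := by
    intro c
    refine vdc2 hδ2 (by positivity) (phs_exp hLp.le r c) (amp_sin hδ le_rfl) ?_
    intro x hx
    have h1 := (exp_bd hd hr ⟨hδ.le.trans hx.1, hx.2⟩).2
    rw [mul_pow, Real.sq_sqrt hLp.le, div_pow, ← Real.exp_nat_mul, ← sq_abs r, hr, one_div_pow]
    have e : ((2:ℕ):ℝ) * -(1 / (4 * d)) = -(1 / (2 * d)) := by push_cast; field_simp; norm_num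
    rw [e]
    calc L * (Real.exp (-(1 / (2 * d))) / d ^ 2) = L * (1 / d ^ 2) * Real.exp (-(1 / (2 * d))) := by ring
      _ ≤ _ := by gcongr
  have hint : ∀ c : ℝ, IntervalIntegrable (fun y : ℝ => ((1 / Real.sin (Real.pi * y) : ℝ) : ℂ) *
      Complex.exp (Complex.I * ((L * Real.exp (r * y) + c * y : ℝ) : ℂ))) volume δ (1/2) := by
    intro c
    apply ContinuousOn.intervalIntegrable
    rw [uIcc_of_le hδ2]
    refine (Complex.continuous_ofReal.comp_continuousOn ?_).mul (by fun_prop)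
    intro x hx
    exact ((amp_sin hδ le_rfl).d x hx).continuousAt.continuousWithinAt
  have e : ∫ y in δ..(1/2), ef L r y * (dk N y : ℂ) = (-Complex.I / 2) *
      ((∫ y in δ..(1/2), ((1 / Real.sin (Real.pi * y) : ℝ) : ℂ) *
      Complex.exp (Complex.I * ((L * Real.exp (r * y) + M * y : ℝ) : ℂ))) -
      (∫ y in δ..(1/2), ((1 / Real.sin (Real.pi * y) : ℝ) : ℂ) *
      Complex.exp (Complex.I * ((L * Real.exp (r * y) + (-M) * y : ℝ) : ℂ)))) := by
    rw [← intervalIntegral.integral_sub (hint _) (hint _), ← intervalIntegral.integral_const_mul]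
    apply intervalIntegral.integral_congr
    intro y hy
    rw [uIcc_of_le hδ2] at hy
    simp only
    rw [dk_eq N (hδ.trans_le hy.1) hy.2, ← hM]
    have hs : ((Real.sin (M * y) : ℝ) : ℂ) = (-Complex.I / 2) *
        (Complex.exp (Complex.I * ((M * y : ℝ) : ℂ)) - Complex.exp (Complex.I * ((-(M * y) : ℝ) : ℂ))) := by
      rw [Complex.ofReal_sin, Complex.sin]
      push_cast
      have : ∀ z : ℂ, Complex.I * -z = -z * Complex.I := fun z => by ring
      rw [this, mul_comm Complex.I]
      ring
    rw [Complex.ofReal_mul, hs]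
    unfold ef
    rw [Complex.ofReal_add, mul_add, Complex.exp_add, Complex.ofReal_add, mul_add, Complex.exp_add,
      neg_mul M y]
    ring
  rw [e, norm_mul, norm_div, norm_neg, Complex.norm_I]
  have h1 := key M
  have h2 := key (-M)
  have h3 := norm_sub_le (∫ y in δ..(1/2), ((1 / Real.sin (Real.pi * y) : ℝ) : ℂ) *
      Complex.exp (Complex.I * ((L * Real.exp (r * y) + M * y : ℝ) : ℂ)))
      (∫ y in δ..(1/2), ((1 / Real.sin (Real.pi * y) : ℝ) : ℂ) *
      Complex.exp (Complex.I * ((L * Real.exp (r * y) + (-M) * y : ℝ) : ℂ)))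
  rw [Complex.norm_ofNat]
  linarith

end S3

section S4
open MeasureTheory intervalIntegral Set

lemma ef_approx {L r y : ℝ} (hL : 0 ≤ L) (h : |r * y| ≤ 1) :
    ‖ef L r y - Complex.exp (Complex.I * L) * Complex.exp (Complex.I * ((L * r * y : ℝ) : ℂ))‖
      ≤ L * (r * y) ^ 2 := by
  have e : ef L r y = Complex.exp (Complex.I * L) * Complex.exp (Complex.I * ((L * r * y : ℝ) : ℂ)) *
      Complex.exp (Complex.I * ((L * (Real.exp (r * y) - 1 - r * y) : ℝ) : ℂ)) := by
    unfold ef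
    rw [← Complex.exp_add, ← Complex.exp_add]
    congr 1
    push_cast; ring
  have n1 : ∀ x : ℝ, ‖Complex.exp (Complex.I * (x : ℂ))‖ = 1 := fun x => by
    rw [mul_comm, Complex.norm_exp_ofReal_mul_I]
  rw [e]
  have : ∀ z w : ℂ, z * w - z = z * (w - 1) := fun z w => by ring
  rw [this, norm_mul, norm_mul, n1, n1, one_mul, one_mul]
  refine (Real.norm_exp_I_mul_ofReal_sub_one_le).trans ?_
  rw [Real.norm_eq_abs, abs_mul, abs_of_nonneg hL]
  exact mul_le_mul_of_nonneg_left (Real.abs_exp_sub_one_sub_id_le h) hL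

lemma dk_le (N : ℕ) {y : ℝ} (h0 : 0 < y) (h1 : y ≤ 1 / 2) : |dk N y| ≤ 1 / (2 * y) := by
  rw [dk_eq N h0 h1, abs_mul, abs_of_pos (one_div_pos.2 (sin_pos' h0 h1))]
  calc 1 / Real.sin (Real.pi * y) * |Real.sin ((2 * N + 1) * Real.pi * y)| ≤ 1 / (2 * y) * 1 := by
        gcongr
        · exact two_mul_le_sin h0.le h1
        · exact Real.abs_sin_le_one _
    _ = _ := by ring

lemma cos_dk (N : ℕ) (b : ℝ) {δ : ℝ} (h0 : 0 ≤ δ) (h1 : δ ≤ 1 / 2) :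
    |∫ y in (0:ℝ)..δ, 2 * Real.cos (b * y) * dk N y| ≤ 6 := by
  have e : ∫ y in (0:ℝ)..δ, 2 * Real.cos (b * y) * dk N y =
      (∫ y in (0:ℝ)..δ, (1 / Real.sin (Real.pi * y)) * Real.sin (((2 * N + 1) * Real.pi + b) * y)) +
      (∫ y in (0:ℝ)..δ, (1 / Real.sin (Real.pi * y)) * Real.sin (((2 * N + 1) * Real.pi - b) * y)) := by
    rw [← intervalIntegral.integral_add (si_int _ le_rfl h0 h1) (si_int _ le_rfl h0 h1)]
    apply intervalIntegral.integral_congr_ae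
    refine Filter.Eventually.of_forall fun y hy => ?_
    rw [uIoc_of_le h0] at hy
    rw [dk_eq N hy.1 (hy.2.trans h1), add_mul _ b y, sub_mul _ b y, Real.sin_add, Real.sin_sub]
    ring
  rw [e]
  have := si_full ((2 * N + 1) * Real.pi + b) h0 h1
  have := si_full ((2 * N + 1) * Real.pi - b) h0 h1
  exact (abs_add_le _ _).trans (by linarith)

lemma inner_bd (N : ℕ) {d L δ : ℝ} (hd : 0 < d) (hL : 0 ≤ L) (h0 : 0 ≤ δ) (h1 : δ ≤ 1 / 2)
    (h2 : δ ≤ d) (h3 : L * δ ^ 2 ≤ d ^ 2) :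
    ‖∫ y in (0:ℝ)..δ, (ef L (1 / d) y + ef L (-(1 / d)) y) * (dk N y : ℂ)‖ ≤ 7 := by
  set f0 := Complex.exp (Complex.I * L) with hf0
  have c1 := ef_cont L (1 / d)
  have c2 := ef_cont L (-(1 / d))
  have c3 := dk_cont N
  have n0 : ‖f0‖ = 1 := by rw [hf0, mul_comm, Complex.norm_exp_ofReal_mul_I]
  have e : ∫ y in (0:ℝ)..δ, (ef L (1 / d) y + ef L (-(1 / d)) y) * (dk N y : ℂ) =
      (∫ y in (0:ℝ)..δ, (ef L (1 / d) y + ef L (-(1 / d)) y -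
          f0 * ((2 * Real.cos (L / d * y) : ℝ) : ℂ)) * (dk N y : ℂ)) +
      f0 * ((∫ y in (0:ℝ)..δ, 2 * Real.cos (L / d * y) * dk N y : ℝ) : ℂ) := by
    rw [← intervalIntegral.integral_ofReal, ← intervalIntegral.integral_const_mul,
      ← intervalIntegral.integral_add]
    · congr 1; ext y; push_cast; ring
    · apply Continuous.intervalIntegrable; fun_prop
    · apply Continuous.intervalIntegrable; fun_prop
  rw [e]
  have b2 : ‖f0 * ((∫ y in (0:ℝ)..δ, 2 * Real.cos (L / d * y) * dk N y : ℝ) : ℂ)‖ ≤ 6 := by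
    rw [norm_mul, n0, one_mul, Complex.norm_real]
    exact cos_dk N _ h0 h1
  have b1 : ‖∫ y in (0:ℝ)..δ, (ef L (1 / d) y + ef L (-(1 / d)) y -
          f0 * ((2 * Real.cos (L / d * y) : ℝ) : ℂ)) * (dk N y : ℂ)‖ ≤ 1 := by
    have := intervalIntegral.norm_integral_le_of_norm_le_const (a := 0) (b := δ) (C := L * δ / d ^ 2)
      (f := fun y => (ef L (1 / d) y + ef L (-(1 / d)) y -
          f0 * ((2 * Real.cos (L / d * y) : ℝ) : ℂ)) * (dk N y : ℂ)) (by
        intro y hy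
        rw [uIoc_of_le h0] at hy
        have hyd : |1 / d * y| ≤ 1 := by
          rw [abs_of_pos (mul_pos (by positivity) hy.1), one_div, inv_mul_le_iff₀ hd]
          linarith [hy.2]
        have a1 := ef_approx (r := 1 / d) (y := y) hL hyd
        have a2 := ef_approx (r := -(1 / d)) (y := y) hL (by rw [neg_mul, abs_neg]; exact hyd)
        have ec : ((2 * Real.cos (L / d * y) : ℝ) : ℂ) =
            Complex.exp (Complex.I * ((L * (1 / d) * y : ℝ) : ℂ)) +
            Complex.exp (Complex.I * ((L * (-(1 / d)) * y : ℝ) : ℂ)) := by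
          push_cast
          rw [Complex.two_cos]
          congr 2 <;> ring
        rw [norm_mul, Complex.norm_real, Real.norm_eq_abs]
        have hb : ‖ef L (1 / d) y + ef L (-(1 / d)) y - f0 * ((2 * Real.cos (L / d * y) : ℝ) : ℂ)‖ ≤
            2 * (L * (1 / d * y) ^ 2) := by
          rw [ec, mul_add, add_sub_add_comm]
          refine (norm_add_le _ _).trans ((add_le_add a1 a2).trans (le_of_eq ?_))
          ring
        calc _ ≤ 2 * (L * (1 / d * y) ^ 2) * (1 / (2 * y)) :=
              mul_le_mul hb (dk_le N hy.1 (hy.2.trans h1)) (abs_nonneg _) (by positivity)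
          _ = L * y / d ^ 2 := by have := hy.1.ne'; field_simp
          _ ≤ _ := by gcongr; exact hy.2)
    refine this.trans ?_
    rw [sub_zero, abs_of_nonneg h0]
    calc L * δ / d ^ 2 * δ = (L * δ ^ 2) / d ^ 2 := by ring
      _ ≤ 1 := by rw [div_le_one (by positivity)]; exact h3
  exact (norm_add_le _ _).trans (by linarith)

lemma cell_i {d : ℝ} (hd : 0 < d) : ∃ C > 0, ∀ N : ℕ, 3 ≤ N → ∀ L : ℝ, 0 ≤ L →
    ‖cellE N L d‖ ≤ C := by
  obtain ⟨C2, hC2, h2⟩ := cell_ii hd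
  set κ := min (1 / 2) d with hκ
  have hκ0 : 0 < κ := lt_min (by norm_num) hd
  set C1 := 7 + 10 * (1 / κ) / (Real.exp (-(1 / (4 * d))) / d) with hC1
  have hC1p : 0 < C1 := by positivity
  refine ⟨C2 + 1 + C1, by positivity, fun N hN L hL => ?_⟩
  have hN' : (3:ℝ) ≤ N := by exact_mod_cast hN
  rcases le_total L 1 with h | h
  · have := h2 N hN L hL
    have h3 : Real.log N / N ≤ 1 := by
      rw [div_le_one (by linarith)]
      exact (Real.log_le_sub_one_of_pos (by linarith)).trans (by linarith)
    have h4 : 0 ≤ Real.log N / N := div_nonneg (Real.log_nonneg (by linarith)) (by linarith)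
    have h5 : L * (Real.log N / N) ≤ 1 := mul_le_one₀ h h4 h3
    have h6 : ‖cellE N L d‖ ≤ ‖cellE N L d - Complex.exp (Complex.I * L)‖ + ‖Complex.exp (Complex.I * L)‖ := by
      have := norm_add_le (cellE N L d - Complex.exp (Complex.I * L)) (Complex.exp (Complex.I * L))
      simpa using this
    rw [mul_comm Complex.I, Complex.norm_exp_ofReal_mul_I, mul_comm _ Complex.I] at h6
    have h7 : C2 * (L * (Real.log N / N)) ≤ C2 := mul_le_of_le_one_right hC2.le h5
    linarith
  · have hs : 1 ≤ Real.sqrt L := Real.one_le_sqrt.2 h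
    have hs0 : 0 < Real.sqrt L := by linarith
    set δ := κ / Real.sqrt L with hδ
    have hδ0 : 0 < δ := by positivity
    have hδκ : δ ≤ κ := div_le_self hκ0.le hs
    have hδ1 : δ ≤ 1 / 2 := hδκ.trans (min_le_left _ _)
    have hδ2 : δ ≤ d := hδκ.trans (min_le_right _ _)
    have hi := inner_bd N hd hL hδ0.le hδ1 hδ2 (by
      rw [hδ, div_pow, Real.sq_sqrt hL]
      have : L * (κ ^ 2 / L) = κ ^ 2 := by field_simp
      rw [this]
      exact pow_le_pow_left₀ hκ0.le (min_le_right _ _) 2)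
    have o1 := outer_bd N hd h (r := 1 / d) (abs_of_pos (by positivity)) hδ0 hδ1
    have o2 := outer_bd N hd h (r := -(1 / d)) (by rw [abs_neg]; exact abs_of_pos (by positivity)) hδ0 hδ1
    have e : cellE N L d = (∫ y in (0:ℝ)..δ, (ef L (1 / d) y + ef L (-(1 / d)) y) * (dk N y : ℂ)) +
        ((∫ y in δ..(1/2), ef L (1 / d) y * (dk N y : ℂ)) +
        (∫ y in δ..(1/2), ef L (-(1 / d)) y * (dk N y : ℂ))) := by
      unfold cellE
      simp only [add_mul]
      rw [← intervalIntegral.integral_add (efdk_int _ _ _ _ _) (efdk_int _ _ _ _ _),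
        intervalIntegral.integral_add_adjacent_intervals
          ((efdk_int _ _ _ _ _).add (efdk_int _ _ _ _ _)) ((efdk_int _ _ _ _ _).add (efdk_int _ _ _ _ _))]
    have eo : 10 * (1 / (2 * δ)) / (Real.sqrt L * (Real.exp (-(1 / (4 * d))) / d)) =
        5 * (1 / κ) / (Real.exp (-(1 / (4 * d))) / d) := by
      rw [hδ]; field_simp; norm_num
    rw [eo] at o1 o2
    rw [e]
    refine (norm_add_le _ _).trans ((add_le_add hi ((norm_add_le _ _).trans (add_le_add o1 o2))).trans ?_)
    have : C1 = 7 + (5 * (1 / κ) / (Real.exp (-(1 / (4 * d))) / d) +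
       5 * (1 / κ) / (Real.exp (-(1 / (4 * d))) / d)) := by rw [hC1]; ring
    linarith

lemma sum_pm (N : ℕ) (f : ℤ → ℂ) : ∑ n ∈ (Finset.Icc (-(N:ℤ)) N).erase 0, f n =
    ∑ n ∈ Finset.range N, (f (n + 1) + f (-(n + 1))) := by
  induction N with
  | zero => simp
  | succ N ih =>
    have hs : (Finset.Icc (-((N + 1 : ℕ):ℤ)) ((N + 1 : ℕ) : ℤ)).erase 0 =
      insert ((N:ℤ) + 1) (insert (-((N:ℤ) + 1)) ((Finset.Icc (-(N:ℤ)) N).erase 0)) := by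
      ext x
      simp only [Finset.mem_erase, Finset.mem_Icc, Finset.mem_insert]
      push_cast
      omega
    rw [hs, Finset.sum_insert, Finset.sum_insert, ih, Finset.sum_range_succ]
    · ring
    · simp
    · simp; omega

lemma dk_eq_sum (N : ℕ) (y : ℝ) : (dk N y : ℂ) = 1 + ∑ n ∈ (Finset.Icc (-(N:ℤ)) N).erase 0,
    Complex.exp (Complex.I * ((-(2 * Real.pi * n) * y : ℝ) : ℂ)) := by
  rw [sum_pm]
  unfold dk
  push_cast
  congr 1
  refine Finset.sum_congr rfl fun n _ => ?_
  rw [Complex.two_cos, add_comm]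
  congr 2 <;> ring

lemma cellE_eq (N : ℕ) (L d : ℝ) :
    cellE N L d = ∫ y in (-(1/2):ℝ)..(1/2), ef L (1 / d) y * (dk N y : ℂ) := by
  rw [← intervalIntegral.integral_add_adjacent_intervals (b := 0) (efdk_int _ _ _ _ _) (efdk_int _ _ _ _ _)]
  have : ∫ y in (-(1/2):ℝ)..0, ef L (1 / d) y * (dk N y : ℂ) =
      ∫ y in (0:ℝ)..(1/2), ef L (-(1 / d)) y * (dk N y : ℂ) := by
    have := intervalIntegral.integral_comp_neg (a := 0) (b := 1/2) (fun y => ef L (1 / d) y * (dk N y : ℂ))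
    rw [neg_zero] at this
    rw [← this]
    congr 1; ext y
    rw [dk_even]; unfold ef
    congr 6; ring
  rw [this]
  unfold cellE
  simp only [add_mul]
  rw [intervalIntegral.integral_add (efdk_int _ _ _ _ _) (efdk_int _ _ _ _ _), add_comm]

lemma cell_iii {d : ℝ} (hd : 0 < d) : ∃ C > 0, ∀ N : ℕ, 3 ≤ N → ∀ L : ℝ, 0 < L →
    ‖cellE N L d‖ ≤ C * (N / L) := by
  obtain ⟨C1, hC1, h1⟩ := cell_i hd
  set q := (1 / d) * Real.exp (-(1 / (2 * d))) with hq
  have hq0 : 0 < q := by positivity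
  refine ⟨C1 * (4 * Real.pi / q) + 24 / q, by positivity, fun N hN L hL => ?_⟩
  have hN' : (3:ℝ) ≤ N := by exact_mod_cast hN
  have hNp : (0:ℝ) < N := by linarith
  rcases le_total (L * q) (4 * Real.pi * N) with h | h
  · have h2 := h1 N hN L hL.le
    have h3 : 1 ≤ (4 * Real.pi / q) * (N / L) := by
      rw [div_mul_div_comm, le_div_iff₀ (by positivity)]
      linarith
    have h4 : C1 ≤ C1 * ((4 * Real.pi / q) * (N / L)) := le_mul_of_one_le_right hC1.le h3
    have h5 : 0 ≤ 24 / q * (N / L) := by positivity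
    rw [add_mul, mul_assoc]
    linarith
  · have key : ∀ n : ℤ, |(n:ℝ)| ≤ N → ‖∫ y in (-(1/2):ℝ)..(1/2), ef L (1 / d) y *
        Complex.exp (Complex.I * ((-(2 * Real.pi * n) * y : ℝ) : ℂ))‖ ≤ 8 / (L * q) := by
      intro n hn
      have := vdc1 (a := -(1/2)) (b := 1/2) (μ := L * q / 2) (by norm_num) (by positivity)
        (phs_exp hL.le (1 / d) (-(2 * Real.pi * n))) (amp_one _ _) (Or.inl fun x hx => by
          have hx1 := hx.1
          have : -(1 / (2 * d)) ≤ 1 / d * x := by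
            calc -(1 / (2 * d)) = 1 / d * (-(1/2)) := by field_simp
              _ ≤ _ := by gcongr
          have h3 : L * q ≤ L * (1 / d) * Real.exp (1 / d * x) := by
            rw [hq, ← mul_assoc]; gcongr
          have h4 := (abs_le.1 hn).2
          have h5 : 2 * Real.pi * n ≤ 2 * Real.pi * N := by gcongr
          linarith)
      refine (le_of_eq ?_).trans (this.trans (le_of_eq ?_))
      · congr 2; ext y
        unfold ef
        rw [Complex.ofReal_add, mul_add, Complex.exp_add]; simp
      · field_simp; norm_num
    have e : cellE N L d = (∫ y in (-(1/2):ℝ)..(1/2), ef L (1 / d) y) +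
        ∑ n ∈ (Finset.Icc (-(N:ℤ)) N).erase 0, ∫ y in (-(1/2):ℝ)..(1/2), ef L (1 / d) y *
        Complex.exp (Complex.I * ((-(2 * Real.pi * n) * y : ℝ) : ℂ)) := by
      have c1 := ef_cont L (1 / d)
      rw [cellE_eq]
      rw [← intervalIntegral.integral_finsetSum (fun i _ => by
        apply Continuous.intervalIntegrable; fun_prop), ← intervalIntegral.integral_add
          (by apply Continuous.intervalIntegrable; fun_prop) (by apply Continuous.intervalIntegrable; fun_prop)]
      congr 1; ext y
      rw [dk_eq_sum, mul_add, Finset.mul_sum, mul_one]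
    have k0 := key 0 (by simp)
    simp only [Int.cast_zero, mul_zero, neg_zero, zero_mul, Complex.ofReal_zero, Complex.exp_zero, mul_one] at k0
    rw [e, sum_pm]
    have hsum : ‖∑ n ∈ Finset.range N, ((∫ y in (-(1/2):ℝ)..(1/2), ef L (1 / d) y *
        Complex.exp (Complex.I * ((-(2 * Real.pi * ((n + 1 : ℤ) : ℝ)) * y : ℝ) : ℂ))) +
        ∫ y in (-(1/2):ℝ)..(1/2), ef L (1 / d) y *
        Complex.exp (Complex.I * ((-(2 * Real.pi * ((-(n + 1) : ℤ) : ℝ)) * y : ℝ) : ℂ)))‖ ≤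
        ∑ n ∈ Finset.range N, (8 / (L * q) + 8 / (L * q)) := by
      refine (norm_sum_le _ _).trans (Finset.sum_le_sum fun n hn => ?_)
      have hn' : ((n:ℝ) + 1) ≤ N := by exact_mod_cast Finset.mem_range.1 hn
      refine (norm_add_le _ _).trans (add_le_add (key (n + 1) ?_) (key (-(n + 1)) ?_))
      · push_cast; rw [abs_of_pos (by positivity)]; exact hn'
      · push_cast; rw [abs_of_neg (by linarith [(Nat.cast_nonneg n : (0:ℝ) ≤ n)])]; linarith
    rw [Finset.sum_const, Finset.card_range, nsmul_eq_mul] at hsum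
    refine (norm_add_le _ _).trans ((add_le_add k0 hsum).trans ?_)
    have : 8 / (L * q) + N * (8 / (L * q) + 8 / (L * q)) ≤ 24 / q * (N / L) := by
      have e2 : 24 / q * (N / L) = N * (8 / (L * q)) + N * (8 / (L * q) + 8 / (L * q)) := by
        field_simp; norm_num
      rw [e2]
      have : 8 / (L * q) ≤ N * (8 / (L * q)) := le_mul_of_one_le_left (by positivity) (by linarith)
      linarith
    have h5 : 0 ≤ C1 * (4 * Real.pi / q) * (N / L) := by positivity
    rw [add_mul]; linarith

end S4

section S5
open MeasureTheory intervalIntegral Set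

lemma geo_sum {d Y : ℝ} (hd : 0 < d) (hY : 1 ≤ Y) (S : Finset ℕ) :
    ∑ j ∈ S, min 1 (Y * Real.exp (-(j / d))) ≤ d * Real.log Y + 1 + 1 / (1 - Real.exp (-(1 / d))) := by
  set q := Real.exp (-(1 / d)) with hq
  have hq1 : q < 1 := by rw [hq]; exact Real.exp_lt_one_iff.2 (neg_lt_zero.2 (by positivity))
  have hq0 : 0 < q := Real.exp_pos _
  have hY0 : 0 < Y := by linarith
  set J0 := ⌈d * Real.log Y⌉₊ with hJ0
  have hJ : (J0:ℝ) ≤ d * Real.log Y + 1 :=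
    (Nat.ceil_lt_add_one (mul_nonneg hd.le (Real.log_nonneg hY))).le
  have hJ' : d * Real.log Y ≤ J0 := Nat.le_ceil _
  obtain ⟨K, hK⟩ : ∃ K : ℕ, ∀ j ∈ S, j < K := by
    obtain ⟨K, hK⟩ := S.exists_nat_subset_range
    exact ⟨K, fun j hj => Finset.mem_range.1 (hK hj)⟩
  have hsub : S ⊆ Finset.range (J0 + K) := fun j hj => Finset.mem_range.2 (by have := hK j hj; omega)
  calc ∑ j ∈ S, min 1 (Y * Real.exp (-(j / d)))
      ≤ ∑ j ∈ Finset.range (J0 + K), min 1 (Y * Real.exp (-(j / d))) :=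
        Finset.sum_le_sum_of_subset_of_nonneg hsub (fun j _ _ => le_min zero_le_one (by positivity))
    _ = ∑ j ∈ Finset.range J0, min 1 (Y * Real.exp (-(j / d))) +
        ∑ j ∈ Finset.range K, min 1 (Y * Real.exp (-(((J0 + j : ℕ) : ℝ) / d))) := by
        rw [Finset.sum_range_add]
    _ ≤ ∑ j ∈ Finset.range J0, (1:ℝ) + ∑ j ∈ Finset.range K, q ^ j := by
        refine add_le_add (Finset.sum_le_sum fun j _ => min_le_left _ _)
          (Finset.sum_le_sum fun j _ => (min_le_right _ _).trans ?_)
        have : Y * Real.exp (-((J0:ℝ) / d)) ≤ 1 := by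
          rw [Real.exp_neg, ← div_eq_mul_inv, div_le_one (Real.exp_pos _), ← Real.log_le_iff_le_exp hY0,
            le_div_iff₀ hd]
          linarith
        calc Y * Real.exp (-(((J0 + j : ℕ) : ℝ) / d)) = (Y * Real.exp (-((J0:ℝ) / d))) * q ^ j := by
              rw [hq, ← Real.exp_nat_mul, mul_assoc, ← Real.exp_add]
              congr 2; push_cast; ring
          _ ≤ 1 * q ^ j := by gcongr
          _ = q ^ j := one_mul _
    _ ≤ J0 + 1 / (1 - q) := by
        refine add_le_add (by simp) ?_
        rw [geom_sum_eq hq1.ne, ← neg_div_neg_eq, neg_sub, neg_sub]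
        apply div_le_div_of_nonneg_right _ (by linarith)
        have := pow_pos hq0 K
        linarith
    _ ≤ _ := by linarith

lemma geo_sum_int {d Y : ℝ} (hd : 0 < d) (hY : 1 ≤ Y) (S : Finset ℤ) (φ : ℤ → ℕ)
    (hφ : Set.InjOn φ S) :
    ∑ h ∈ S, min 1 (Y * Real.exp (-(φ h / d))) ≤
      d * Real.log Y + 1 + 1 / (1 - Real.exp (-(1 / d))) := by
  have := geo_sum hd hY (S.image φ)
  rwa [Finset.sum_image hφ] at this

lemma cells (N J : ℕ) (h0 : ℤ) (A d : ℝ) :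
    ∫ y in ((h0:ℝ) + 1/2)..((h0:ℝ) + 1/2 + J), ef A (1 / d) y * (dk N y : ℂ) =
    ∑ h ∈ Finset.Ioc h0 (h0 + J), cellE N (A * Real.exp (h / d)) d := by
  induction J with
  | zero => simp
  | succ J ih =>
    have hs : Finset.Ioc h0 (h0 + ((J + 1 : ℕ):ℤ)) = insert (h0 + J + 1) (Finset.Ioc h0 (h0 + J)) := by
      ext x; simp only [Finset.mem_Ioc, Finset.mem_insert]; push_cast; omega
    rw [hs, Finset.sum_insert (by simp), ← ih,
      ← intervalIntegral.integral_add_adjacent_intervals (b := (h0:ℝ) + 1/2 + J) (efdk_int _ _ _ _ _)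
        (efdk_int _ _ _ _ _), add_comm, cellE_eq]
    congr 1
    have := intervalIntegral.integral_comp_add_right (a := -(1/2)) (b := 1/2)
      (fun y => ef A (1 / d) y * (dk N y : ℂ)) (((h0 + J + 1 : ℤ)) : ℝ)
    have e1 : -(1/2) + ((h0 + J + 1 : ℤ) : ℝ) = (h0:ℝ) + 1/2 + J := by push_cast; ring
    have e2 : (1/2) + ((h0 + J + 1 : ℤ) : ℝ) = (h0:ℝ) + 1/2 + (J + 1 : ℕ) := by push_cast; ring
    rw [e1, e2] at this
    rw [← this]
    congr 1; ext y
    rw [dk_add_int]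
    congr 1
    unfold ef
    rw [mul_assoc A, ← Real.exp_add]
    congr 5; ring

lemma mainA {d A0 : ℝ} (hd : 0 < d) (hA0 : 0 < A0) (h0 : ℤ) (hh0 : h0 ≤ 0) :
    ∃ C > 0, ∀ A ≥ A0, ∀ N : ℕ, 16 ≤ N → ∀ J : ℕ, ⌈d * Real.log N⌉ ≤ h0 + J →
    ‖(∫ y in ((h0:ℝ) + 1/2)..((h0:ℝ) + 1/2 + J), ef A (1 / d) y * (dk N y : ℂ)) -
      ∑ h ∈ Finset.Ioo (0:ℤ) ⌈d * Real.log N⌉, ef A (1 / d) h‖ ≤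
      C * (1 + Real.log (1 + A) + Real.log (Real.log N)) := by
  obtain ⟨C1, hC1, b1⟩ := cell_i hd
  obtain ⟨C2, hC2, b2⟩ := cell_ii hd
  obtain ⟨C3, hC3, b3⟩ := cell_iii hd
  set q := 1 / (1 - Real.exp (-(1 / d))) with hq
  have hq0 : 0 < q := by
    apply one_div_pos.2
    have : Real.exp (-(1 / d)) < 1 := Real.exp_lt_one_iff.2 (neg_lt_zero.2 (by positivity))
    linarith
  set D := C1 * (-h0 : ℤ) + (C1 + 1 + C2) * (d + 1 + q) + (C3 / A0 + C1) * (1 + q) with hD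
  have hh0' : (0:ℝ) ≤ ((-h0 : ℤ) : ℝ) := by exact_mod_cast (by omega : 0 ≤ -h0)
  refine ⟨D, by positivity, fun A hA N hN J hJ => ?_⟩
  have hAp : 0 < A := hA0.trans_le hA
  have hN' : (16:ℝ) ≤ N := by exact_mod_cast hN
  have hNp : (0:ℝ) < N := by linarith
  have hlog1 : 1 ≤ Real.log N := by
    rw [Real.le_log_iff_exp_le hNp]
    exact Real.exp_one_lt_three.le.trans (by linarith)
  have hll : 0 ≤ Real.log (Real.log N) := Real.log_nonneg hlog1
  have hlA : 0 ≤ Real.log (1 + A) := Real.log_nonneg (by linarith)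
  set P := ⌈d * Real.log N⌉ with hP
  have hP0 : 0 < P := Int.ceil_pos.2 (by positivity)
  have hP1 : d * Real.log N ≤ P := Int.le_ceil _
  have hP2 : (P:ℝ) - 1 < d * Real.log N := by have := Int.ceil_lt_add_one (d * Real.log N); linarith
  have hNe : Real.exp (Real.log N) = N := Real.exp_log hNp
  have hle1 : (N:ℝ) ≤ Real.exp (P / d) := by
    rw [← hNe, Real.exp_le_exp, le_div_iff₀ hd]; linarith
  have hle2 : Real.exp ((P - 1) / d) ≤ N := by
    rw [← hNe, Real.exp_le_exp, div_le_iff₀ hd]; linarith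
  have hef : ∀ h : ℤ, ef A (1 / d) h = Complex.exp (Complex.I * ((A * Real.exp (h / d) : ℝ) : ℂ)) := by
    intro h; unfold ef; congr 5; ring
  have hset : Finset.Ioc h0 (h0 + J) = Finset.Ioc h0 0 ∪ (Finset.Ioo 0 P ∪ Finset.Icc P (h0 + J)) := by
    ext x; simp only [Finset.mem_Ioc, Finset.mem_union, Finset.mem_Ioo, Finset.mem_Icc]; omega
  have hd1 : Disjoint (Finset.Ioc h0 0) (Finset.Ioo 0 P ∪ Finset.Icc P (h0 + J)) := by
    rw [Finset.disjoint_left]; intro x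
    simp only [Finset.mem_Ioc, Finset.mem_union, Finset.mem_Ioo, Finset.mem_Icc]; omega
  have hd2 : Disjoint (Finset.Ioo 0 P) (Finset.Icc P (h0 + J)) := by
    rw [Finset.disjoint_left]; intro x
    simp only [Finset.mem_Ioo, Finset.mem_Icc]; omega
  rw [cells, hset, Finset.sum_union hd1, Finset.sum_union hd2]
  have er : ∀ x y z w : ℂ, x + (y + z) - w = x + ((y - w) + z) := fun x y z w => by ring
  rw [er, ← Finset.sum_sub_distrib]
  have S1 : ‖∑ h ∈ Finset.Ioc h0 0, cellE N (A * Real.exp (h / d)) d‖ ≤ C1 * (-h0 : ℤ) := by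
    refine (norm_sum_le _ _).trans ((Finset.sum_le_sum fun h _ => b1 N (by omega) _ (by positivity)).trans ?_)
    rw [Finset.sum_const, Int.card_Ioc, nsmul_eq_mul, mul_comm]
    have : (((0 - h0).toNat : ℕ) : ℝ) = ((-h0 : ℤ) : ℝ) := by
      rw [← Int.cast_natCast, Int.toNat_of_nonneg (by omega)]; simp
    rw [this]
  set Y := (1 + A) * Real.log N with hY
  have hY1 : 1 ≤ Y := one_le_mul_of_one_le_of_one_le (by linarith) hlog1
  have S2 : ‖∑ h ∈ Finset.Ioo 0 P, (cellE N (A * Real.exp (h / d)) d - ef A (1 / d) h)‖ ≤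
      (C1 + 1 + C2) * (d * Real.log Y + 1 + q) := by
    have hg := geo_sum_int hd hY1 (Finset.Ioo 0 P) (fun h => (P - 1 - h).toNat) (by
      intro x hx y hy hxy
      simp only [Finset.coe_Ioo, Set.mem_Ioo] at hx hy
      simp only at hxy
      omega)
    refine (norm_sum_le _ _).trans (le_trans ?_ (mul_le_mul_of_nonneg_left hg (by positivity)))
    rw [Finset.mul_sum]
    refine Finset.sum_le_sum fun h hh => ?_
    rw [Finset.mem_Ioo] at hh
    have hcast : (((P - 1 - h).toNat : ℕ) : ℝ) = P - 1 - h := by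
      rw [← Int.cast_natCast, Int.toNat_of_nonneg (by omega)]; push_cast; ring
    simp only [hcast]
    rw [mul_min_of_nonneg _ _ (by positivity)]
    refine le_min ?_ ?_
    · have := b1 N (by omega) (A * Real.exp (h / d)) (by positivity)
      refine (norm_sub_le _ _).trans ?_
      rw [ef_norm]; linarith
    · have := b2 N (by omega) (A * Real.exp (h / d)) (by positivity)
      rw [hef]
      refine this.trans ?_
      have e3 : Real.exp (h / d) / N ≤ Real.exp (-((P - 1 - h) / d)) := by
        rw [div_le_iff₀ hNp]
        calc Real.exp (h / d) = Real.exp (-((P - 1 - h) / d)) * Real.exp ((P - 1) / d) := by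
              rw [← Real.exp_add]; congr 1; ring
          _ ≤ _ := by gcongr
      calc C2 * (A * Real.exp (h / d) * (Real.log N / N)) = C2 * (A * Real.log N * (Real.exp (h / d) / N)) := by ring
        _ ≤ (C1 + 1 + C2) * ((1 + A) * Real.log N * Real.exp (-((P - 1 - h) / d))) := by
            gcongr
            · linarith
            · linarith
  have S3 : ‖∑ h ∈ Finset.Icc P (h0 + J), cellE N (A * Real.exp (h / d)) d‖ ≤ (C3 / A0 + C1) * (1 + q) := by
    have hg := geo_sum_int hd le_rfl (Finset.Icc P (h0 + J)) (fun h => (h - P).toNat) (by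
      intro x hx y hy hxy
      simp only [Finset.coe_Icc, Set.mem_Icc] at hx hy
      simp only at hxy
      omega)
    rw [Real.log_one, mul_zero, zero_add] at hg
    refine (norm_sum_le _ _).trans (le_trans ?_ (mul_le_mul_of_nonneg_left hg (by positivity)))
    rw [Finset.mul_sum]
    refine Finset.sum_le_sum fun h hh => ?_
    rw [Finset.mem_Icc] at hh
    have hcast : (((h - P).toNat : ℕ) : ℝ) = h - P := by
      rw [← Int.cast_natCast, Int.toNat_of_nonneg (by omega)]; push_cast; ring
    simp only [hcast]
    rw [mul_min_of_nonneg _ _ (by positivity)]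
    refine le_min ?_ ?_
    · have := b1 N (by omega) (A * Real.exp (h / d)) (by positivity)
      have : 0 < C3 / A0 := by positivity
      linarith
    · have := b3 N (by omega) (A * Real.exp (h / d)) (by positivity)
      refine this.trans ?_
      have e3 : N / Real.exp (h / d) ≤ Real.exp (-((h - P) / d)) := by
        rw [div_le_iff₀ (Real.exp_pos _), ← Real.exp_add]
        refine hle1.trans (le_of_eq ?_)
        congr 1; ring
      calc C3 * (N / (A * Real.exp (h / d))) = C3 / A * (N / Real.exp (h / d)) := by field_simp
        _ ≤ (C3 / A0 + C1) * (1 * Real.exp (-((h - P) / d))) := by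
          rw [one_mul]
          have : C3 / A ≤ C3 / A0 + C1 := by
            have : C3 / A ≤ C3 / A0 := by gcongr
            linarith
          gcongr
  refine (norm_add_le _ _).trans ((add_le_add S1 ((norm_add_le _ _).trans (add_le_add S2 S3))).trans ?_)
  have hlY : Real.log Y = Real.log (1 + A) + Real.log (Real.log N) :=
    Real.log_mul (by positivity) (by positivity)
  rw [hlY]
  set X := Real.log (1 + A) + Real.log (Real.log N) with hX
  have hX0 : 0 ≤ X := by positivity
  have eX : 1 + Real.log (1 + A) + Real.log (Real.log N) = 1 + X := by rw [hX]; ring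
  rw [eX, hD, add_mul, add_mul]
  have t1 : C1 * ((-h0 : ℤ) : ℝ) ≤ C1 * ((-h0 : ℤ) : ℝ) * (1 + X) :=
    le_mul_of_one_le_right (by positivity) (by linarith)
  have t3 : (C3 / A0 + C1) * (1 + q) ≤ (C3 / A0 + C1) * (1 + q) * (1 + X) :=
    le_mul_of_one_le_right (by positivity) (by linarith)
  have t2 : (C1 + 1 + C2) * (d * X + 1 + q) ≤ (C1 + 1 + C2) * (d + 1 + q) * (1 + X) := by
    rw [mul_assoc]
    gcongr
    nlinarith [mul_nonneg hq0.le hX0]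
  linarith

lemma In_bd {d : ℝ} (hd : 0 < d) : ∃ C > 0, ∀ A > 0, ∀ n : ℤ, n ≠ 0 → ∀ a b : ℝ, a ≤ b →
    ‖∫ y in a..b, ef A (1 / d) y * Complex.exp (Complex.I * ((-(2 * Real.pi * n) * y : ℝ) : ℂ))‖ ≤
      C / Real.sqrt |(n:ℝ)| := by
  refine ⟨4 / Real.pi + 10 / Real.sqrt (Real.pi / d), by positivity, fun A hA n hn a b hab => ?_⟩
  set t := |(n:ℝ)| with ht
  have ht1 : 1 ≤ t := by
    rw [ht, ← Int.cast_abs]; exact_mod_cast Int.one_le_abs hn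
  have ht0 : 0 < t := by linarith
  have hπ := Real.pi_pos
  have e : (fun y => ef A (1 / d) y * Complex.exp (Complex.I * ((-(2 * Real.pi * n) * y : ℝ) : ℂ))) =
      fun y => (((fun _ => 1 : ℝ → ℝ) y : ℝ) : ℂ) *
        Complex.exp (Complex.I * ((A * Real.exp (1 / d * y) + (-(2 * Real.pi * n)) * y : ℝ) : ℂ)) := by
    ext y
    unfold ef
    rw [Complex.ofReal_add, mul_add, Complex.exp_add]; simp
  rw [e]
  have hphs := phs_exp hA.le (1 / d) (-(2 * Real.pi * n))
  set ys := d * Real.log (Real.pi * t * d / A) with hys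
  have hys' : A * (1 / d) * Real.exp (1 / d * ys) = Real.pi * t := by
    rw [hys, ← mul_assoc, one_div_mul_cancel hd.ne', one_mul, Real.exp_log (by positivity)]
    field_simp
  set c := max a (min b ys) with hc
  have hac : a ≤ c := le_max_left _ _
  have hcb : c ≤ b := max_le hab (min_le_left _ _)
  have hcont : Continuous fun y : ℝ => (((fun _ => 1 : ℝ → ℝ) y : ℝ) : ℂ) *
        Complex.exp (Complex.I * ((A * Real.exp (1 / d * y) + (-(2 * Real.pi * n)) * y : ℝ) : ℂ)) := by
    fun_prop
  rw [← intervalIntegral.integral_add_adjacent_intervals (hcont.intervalIntegrable a c)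
    (hcont.intervalIntegrable c b)]
  have I1 : ‖∫ y in a..c, (((fun _ => 1 : ℝ → ℝ) y : ℝ) : ℂ) *
        Complex.exp (Complex.I * ((A * Real.exp (1 / d * y) + (-(2 * Real.pi * n)) * y : ℝ) : ℂ))‖ ≤
        4 / Real.pi / Real.sqrt t := by
    rcases hac.eq_or_lt with h | h
    · rw [← h]; simp; positivity
    · have hcy : c ≤ ys := by
        rcases max_choice a (min b ys) with h1 | h1
        · exact absurd (hc.trans h1) h.ne'
        · rw [hc, h1]; exact min_le_right _ _
      have hup : ∀ x ∈ Icc a c, A * (1 / d) * Real.exp (1 / d * x) ≤ Real.pi * t := by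
        intro x hx
        rw [← hys']
        have : x ≤ ys := hx.2.trans hcy
        gcongr
      have := vdc1 hac (μ := Real.pi * t) (by positivity) hphs (amp_one _ _) (by
        rcases lt_or_gt_of_ne hn with h2 | h2
        · left
          intro x _
          have : t = -n := by rw [ht]; exact abs_of_neg (by exact_mod_cast h2)
          have h3 : 0 ≤ A * (1 / d) * Real.exp (1 / d * x) := by positivity
          have h4 : -(2 * Real.pi * n) = 2 * (Real.pi * t) := by rw [this]; ring
          have : 0 < Real.pi * t := by positivity
          linarith
        · right
          intro x hx
          have : t = n := by rw [ht]; exact abs_of_pos (by exact_mod_cast h2)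
          have h4 : -(2 * Real.pi * n) = -(2 * (Real.pi * t)) := by rw [this]; ring
          have := hup x hx
          linarith)
      refine this.trans ?_
      rw [div_div]
      have : Real.sqrt t ≤ t := by
        rw [Real.sqrt_le_left ht0.le]; nlinarith
      rw [mul_one]
      gcongr
  have I2 : ‖∫ y in c..b, (((fun _ => 1 : ℝ → ℝ) y : ℝ) : ℂ) *
        Complex.exp (Complex.I * ((A * Real.exp (1 / d * y) + (-(2 * Real.pi * n)) * y : ℝ) : ℂ))‖ ≤
        10 / Real.sqrt (Real.pi / d) / Real.sqrt t := by
    rcases hcb.eq_or_lt with h | h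
    · rw [h]; simp; positivity
    · have hcy : ys ≤ c := by
        have h1 : min b ys ≤ c := le_max_right _ _
        rcases min_choice b ys with h2 | h2
        · rw [h2] at h1; linarith
        · rwa [h2] at h1
      have := vdc2 hcb (l := Real.sqrt (Real.pi / d) * Real.sqrt t) (by positivity) hphs (amp_one _ _) (by
        intro x hx
        rw [mul_pow, Real.sq_sqrt (by positivity), Real.sq_sqrt ht0.le]
        have h3 : Real.pi * t ≤ A * (1 / d) * Real.exp (1 / d * x) := by
          rw [← hys']
          have : ys ≤ x := hcy.trans hx.1
          gcongr
        calc Real.pi / d * t = (1 / d) * (Real.pi * t) := by ring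
          _ ≤ (1 / d) * (A * (1 / d) * Real.exp (1 / d * x)) := by gcongr
          _ = _ := by ring)
      rwa [mul_one, ← div_div] at this
  refine (norm_add_le _ _).trans ((add_le_add I1 I2).trans (le_of_eq ?_))
  ring

lemma I0_bd {d A0 : ℝ} (hd : 0 < d) (hA0 : 0 < A0) (a : ℝ) : ∃ C > 0, ∀ A ≥ A0, ∀ b : ℝ, a ≤ b →
    ‖∫ y in a..b, ef A (1 / d) y‖ ≤ C := by
  refine ⟨4 * 1 / (A0 * (1 / d) * Real.exp (1 / d * a)), by positivity, fun A hA b hab => ?_⟩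
  have := vdc1 hab (μ := A0 * (1 / d) * Real.exp (1 / d * a)) (by positivity)
    (phs_exp (hA0.le.trans hA) (1 / d) 0) (amp_one _ _) (Or.inl fun x hx => by
      have := hx.1
      have hA : A0 ≤ A := hA
      have hAp : 0 < A := hA0.trans_le hA
      rw [add_zero]
      gcongr)
  refine (le_of_eq ?_).trans this
  congr 2; ext y; unfold ef; simp

end S5

section S6
open MeasureTheory intervalIntegral Set

noncomputable def Qf (β : ℤ → ℂ) (d : ℝ) (h0 : ℤ) (N J : ℕ) (g : ℝ → ℂ) : ℂ :=
  ∑ n ∈ (Finset.Icc (-(N:ℤ)) N).erase 0, β n * (∫ y in ((h0:ℝ) + 1/2)..((h0:ℝ) + 1/2 + J),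
    g y * Complex.exp (Complex.I * ((-(2 * Real.pi * n) * y : ℝ) : ℂ))) -
  ∑ h ∈ Finset.Ioo (0:ℤ) ⌈d * Real.log N⌉, g h

lemma Qf_conj (β : ℤ → ℂ) (d : ℝ) (h0 : ℤ) (N J : ℕ) (g : ℝ → ℂ) :
    Qf β d h0 N J (fun y => (starRingEnd ℂ) (g y)) =
      (starRingEnd ℂ) (Qf (fun n => (starRingEnd ℂ) (β (-n))) d h0 N J g) := by
  unfold Qf
  rw [map_sub, map_sum, map_sum, sum_pm, sum_pm]
  congr 1
  refine Finset.sum_congr rfl fun n _ => ?_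
  have key : ∀ m : ℤ, (starRingEnd ℂ) ((starRingEnd ℂ) (β (-m)) * ∫ y in ((h0:ℝ) + 1/2)..((h0:ℝ) + 1/2 + J),
    g y * Complex.exp (Complex.I * ((-(2 * Real.pi * m) * y : ℝ) : ℂ))) =
    β (-m) * ∫ y in ((h0:ℝ) + 1/2)..((h0:ℝ) + 1/2 + J),
    (starRingEnd ℂ) (g y) * Complex.exp (Complex.I * ((-(2 * Real.pi * ((-m : ℤ):ℝ)) * y : ℝ) : ℂ)) := by
    intro m
    rw [map_mul, Complex.conj_conj]
    congr 1
    simp only [intervalIntegral, map_sub, ← integral_conj]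
    congr 1 <;>
    · congr 1; ext y
      rw [map_mul, ← Complex.exp_conj, map_mul, Complex.conj_I, Complex.conj_ofReal]
      congr 2; push_cast; ring
  rw [key, key, neg_neg, add_comm]

lemma Qf_ef {d A0 B : ℝ} (hd : 0 < d) (hA0 : 0 < A0) (hB : 0 ≤ B) (h0 : ℤ) (hh0 : h0 ≤ 0) :
    ∃ C > 0, ∀ β : ℤ → ℂ, (∀ n ≠ 0, ‖β n - 1‖ ≤ B / |(n:ℝ)|) → ∀ A ≥ A0, ∀ N : ℕ, 16 ≤ N →
    ∀ J : ℕ, ⌈d * Real.log N⌉ ≤ h0 + J →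
    ‖Qf β d h0 N J (ef A (1 / d))‖ ≤ C * (1 + Real.log (1 + A) + Real.log (Real.log N)) := by
  obtain ⟨C1, hC1, b1⟩ := mainA hd hA0 h0 hh0
  obtain ⟨C2, hC2, b2⟩ := In_bd hd
  obtain ⟨C3, hC3, b3⟩ := I0_bd hd hA0 ((h0:ℝ) + 1/2)
  have hs := Real.summable_abs_int_rpow (b := 3/2) (by norm_num)
  set Z := ∑' n : ℤ, |(n:ℝ)| ^ (-(3/2) : ℝ) with hZ
  have hZ0 : 0 ≤ Z := tsum_nonneg fun n => by positivity
  refine ⟨C1 + C3 + B * C2 * Z, by positivity, fun β hβ A hA N hN J hJ => ?_⟩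
  have hN' : (16:ℝ) ≤ N := by exact_mod_cast hN
  have hNp : (0:ℝ) < N := by linarith
  have hlog1 : 1 ≤ Real.log N := by
    rw [Real.le_log_iff_exp_le hNp]
    exact Real.exp_one_lt_three.le.trans (by linarith)
  have hll : 0 ≤ Real.log (Real.log N) := Real.log_nonneg hlog1
  have hlA : 0 ≤ Real.log (1 + A) := Real.log_nonneg (by linarith [hA0.trans_le hA])
  have m1 := b1 A hA N hN J hJ
  have m3 := b3 A hA ((h0:ℝ) + 1/2 + J) (by have : (0:ℝ) ≤ J := by positivity
                                            linarith)
  set a := (h0:ℝ) + 1/2 with ha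
  have hab : a ≤ a + J := by have : (0:ℝ) ≤ J := by positivity
                             linarith
  have c1 := ef_cont A (1 / d)
  have e : ∫ y in a..(a + J), ef A (1 / d) y * (dk N y : ℂ) = (∫ y in a..(a + J), ef A (1 / d) y) +
      ∑ n ∈ (Finset.Icc (-(N:ℤ)) N).erase 0, ∫ y in a..(a + J),
        ef A (1 / d) y * Complex.exp (Complex.I * ((-(2 * Real.pi * n) * y : ℝ) : ℂ)) := by
    rw [← intervalIntegral.integral_finsetSum (fun i _ => by
        apply Continuous.intervalIntegrable; fun_prop), ← intervalIntegral.integral_add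
          (by apply Continuous.intervalIntegrable; fun_prop) (by apply Continuous.intervalIntegrable; fun_prop)]
    congr 1; ext y
    rw [dk_eq_sum, mul_add, Finset.mul_sum, mul_one]
  have e2 : Qf β d h0 N J (ef A (1 / d)) =
      ((∫ y in a..(a + J), ef A (1 / d) y * (dk N y : ℂ)) -
        ∑ h ∈ Finset.Ioo (0:ℤ) ⌈d * Real.log N⌉, ef A (1 / d) h) - (∫ y in a..(a + J), ef A (1 / d) y) +
      ∑ n ∈ (Finset.Icc (-(N:ℤ)) N).erase 0, (β n - 1) * ∫ y in a..(a + J),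
        ef A (1 / d) y * Complex.exp (Complex.I * ((-(2 * Real.pi * n) * y : ℝ) : ℂ)) := by
    rw [e]
    unfold Qf
    simp only [sub_mul, one_mul, Finset.sum_sub_distrib]
    ring
  have m2 : ‖∑ n ∈ (Finset.Icc (-(N:ℤ)) N).erase 0, (β n - 1) * ∫ y in a..(a + J),
        ef A (1 / d) y * Complex.exp (Complex.I * ((-(2 * Real.pi * n) * y : ℝ) : ℂ))‖ ≤ B * C2 * Z := by
    refine (norm_sum_le _ _).trans ?_
    refine le_trans ?_ (mul_le_mul_of_nonneg_left
      (hs.sum_le_tsum ((Finset.Icc (-(N:ℤ)) N).erase 0) (fun i _ => by positivity)) (by positivity))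
    rw [Finset.mul_sum]
    refine Finset.sum_le_sum fun n hn => ?_
    have hn0 : n ≠ 0 := (Finset.mem_erase.1 hn).1
    have hnp : 0 < |(n:ℝ)| := abs_pos.2 (by exact_mod_cast hn0)
    rw [norm_mul]
    refine (mul_le_mul (hβ n hn0) (b2 A (hA0.trans_le hA) n hn0 a (a + J) hab) (norm_nonneg _) (by positivity)).trans
      (le_of_eq ?_)
    rw [Real.rpow_neg hnp.le, show (3/2:ℝ) = 1 + 1/2 by norm_num, Real.rpow_add hnp, Real.rpow_one,
      ← Real.sqrt_eq_rpow]
    field_simp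
  rw [e2]
  refine (norm_add_le _ _).trans ((add_le_add ((norm_sub_le _ _).trans (add_le_add m1 m3)) m2).trans ?_)
  set X := Real.log (1 + A) + Real.log (Real.log N) with hX
  have hX0 : 0 ≤ X := by positivity
  have eX : 1 + Real.log (1 + A) + Real.log (Real.log N) = 1 + X := by rw [hX]; ring
  rw [eX]
  nlinarith [mul_nonneg hC3.le hX0, mul_nonneg (mul_nonneg (mul_nonneg hB hC2.le) hZ0) hX0]

lemma psi_hasSum {k : ℕ} (hk : 2 ≤ k) (x : ℝ) :
    HasSum (fun n : ℤ => 1 / (n : ℂ) ^ k * Complex.exp (Complex.I * ((2 * Real.pi * n * x : ℝ) : ℂ)))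
      (-(2 * Real.pi * Complex.I) ^ k / (Nat.factorial k) * (bernoulliFun k (Int.fract x) : ℂ)) := by
  have := hasSum_one_div_pow_mul_fourier_mul_bernoulliFun hk (x := Int.fract x)
    ⟨Int.fract_nonneg x, (Int.fract_lt_one x).le⟩
  convert! this using 1
  ext n
  rw [show ((Int.fract x : ℝ) : UnitAddCircle) = ((x : ℝ) : UnitAddCircle) from AddCircle.coe_fract x,
    fourier_coe_apply]
  congr 2; push_cast; ring

lemma Qf_psi {d B : ℝ} (θ : ℝ) (hd : 0 < d) (hB : 0 ≤ B) (h0 : ℤ) (hh0 : h0 ≤ 0) {k : ℕ} (hk : 2 ≤ k) :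
    ∃ C > 0, ∀ β : ℤ → ℂ, (∀ n ≠ 0, ‖β n - 1‖ ≤ B / |(n:ℝ)|) → ∀ N : ℕ, 16 ≤ N →
    ∀ J : ℕ, ⌈d * Real.log N⌉ ≤ h0 + J →
    ‖Qf β d h0 N J (fun y => (bernoulliFun k (Int.fract (Real.exp ((y + θ) / d))) : ℂ))‖ ≤
      C * (1 + Real.log (Real.log N)) := by
  set A0 := 2 * Real.pi * Real.exp (θ / d) with hA0
  have hA0p : 0 < A0 := by have := Real.pi_pos; positivity
  obtain ⟨C, hC, b⟩ := Qf_ef hd hA0p hB h0 hh0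
  have hs := Real.summable_abs_int_rpow (b := 3/2) (by norm_num)
  set Z := ∑' n : ℤ, |(n:ℝ)| ^ (-(3/2) : ℝ) with hZ
  have hZ0 : 0 ≤ Z := tsum_nonneg fun n => by positivity
  have hlA : 0 ≤ Real.log (1 + A0) := Real.log_nonneg (by linarith)
  set K : ℂ := -(2 * Real.pi * Complex.I) ^ k / (Nat.factorial k) with hK
  have hK0 : K ≠ 0 := by
    rw [hK]
    have := Real.pi_ne_zero
    have := Nat.factorial_ne_zero k
    apply div_ne_zero (neg_ne_zero.2 (pow_ne_zero _ Complex.two_pi_I_ne_zero))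
    exact_mod_cast this
  refine ⟨‖K‖⁻¹ * (C * (3 + Real.log (1 + A0)) * Z) + 1, by positivity, fun β hβ N hN J hJ => ?_⟩
  have hN' : (16:ℝ) ≤ N := by exact_mod_cast hN
  have hNp : (0:ℝ) < N := by linarith
  have hlog1 : 1 ≤ Real.log N := by
    rw [Real.le_log_iff_exp_le hNp]
    exact Real.exp_one_lt_three.le.trans (by linarith)
  have hll : 0 ≤ Real.log (Real.log N) := Real.log_nonneg hlog1
  set LL := Real.log (Real.log N) with hLL
  set G : ℤ → ℝ → ℂ := fun m y => Complex.exp (Complex.I * ((2 * Real.pi * m * Real.exp ((y + θ) / d) : ℝ) : ℂ))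
    with hG
  have hGn : ∀ m y, ‖G m y‖ = 1 := by
    intro m y; rw [hG]; simp only; rw [mul_comm Complex.I, Complex.norm_exp_ofReal_mul_I]
  have hGc : ∀ m, Continuous (G m) := by intro m; rw [hG]; fun_prop
  have hGs : ∀ y, HasSum (fun m : ℤ => 1 / (m:ℂ) ^ k * G m y)
      (K * (bernoulliFun k (Int.fract (Real.exp ((y + θ) / d))) : ℂ)) :=
    fun y => psi_hasSum hk (Real.exp ((y + θ) / d))
  have hsum0 : Summable fun m : ℤ => ‖1 / (m:ℂ) ^ k‖ := by
    have : (fun x : ℤ => ‖1 / (x : ℂ) ^ k‖) = fun x : ℤ => |1 / (x : ℝ) ^ k| := by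
      ext1 x
      simp only [one_div, norm_inv, norm_pow, Complex.norm_intCast, pow_abs, abs_inv]
    rw [this, summable_abs_iff, Real.summable_one_div_int_pow]
    omega
  have hQ : HasSum (fun m : ℤ => 1 / (m:ℂ) ^ k * Qf β d h0 N J (G m))
      (K * Qf β d h0 N J (fun y => (bernoulliFun k (Int.fract (Real.exp ((y + θ) / d))) : ℂ))) := by
    unfold Qf
    simp only [mul_sub, Finset.mul_sum]
    apply HasSum.sub
    · apply hasSum_sum
      intro n _
      have h1 : HasSum (fun m : ℤ => ∫ y in ((h0:ℝ) + 1/2)..((h0:ℝ) + 1/2 + J), (1 / (m:ℂ) ^ k * G m y) *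
          Complex.exp (Complex.I * ((-(2 * Real.pi * n) * y : ℝ) : ℂ)))
          (∫ y in ((h0:ℝ) + 1/2)..((h0:ℝ) + 1/2 + J),
            (K * (bernoulliFun k (Int.fract (Real.exp ((y + θ) / d))) : ℂ)) *
          Complex.exp (Complex.I * ((-(2 * Real.pi * n) * y : ℝ) : ℂ))) := by
        apply intervalIntegral.hasSum_integral_of_dominated_convergence (fun (m : ℤ) _ => ‖1 / (m:ℂ) ^ k‖)
        · intro m
          have := hGc m
          apply Continuous.aestronglyMeasurable
          fun_prop
        · intro m
          refine Filter.Eventually.of_forall fun y _ => ?_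
          rw [norm_mul, norm_mul, hGn, mul_one, mul_comm Complex.I, Complex.norm_exp_ofReal_mul_I, mul_one]
        · exact Filter.Eventually.of_forall fun y _ => hsum0
        · exact intervalIntegrable_const
        · exact Filter.Eventually.of_forall fun y _ => (hGs y).mul_right _
      convert! h1.mul_left (β n) using 1
      · ext m
        simp only [mul_assoc, intervalIntegral.integral_const_mul]
        ring
      · simp only [mul_assoc, intervalIntegral.integral_const_mul]
        ring
    · apply hasSum_sum
      intro h _
      exact hGs h
  have hlogm : ∀ t : ℝ, 1 ≤ t → Real.log (1 + t * A0) ≤ Real.log (1 + A0) + 2 * Real.sqrt t := by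
    intro t ht
    have h1 : Real.log (1 + t * A0) ≤ Real.log (t * (1 + A0)) := by
      apply Real.log_le_log (by positivity); nlinarith
    have h2 : Real.log t ≤ 2 * Real.sqrt t := by
      have h3 := Real.log_le_sub_one_of_pos (Real.sqrt_pos.2 (by linarith : 0 < t))
      rw [Real.log_sqrt (by linarith)] at h3
      linarith
    rw [Real.log_mul (by positivity) (by positivity)] at h1
    linarith
  have hbd : ∀ t : ℝ, 1 ≤ t → 1 + Real.log (1 + t * A0) + LL ≤ (3 + Real.log (1 + A0)) * (1 + LL) * Real.sqrt t := by
    intro t ht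
    have := hlogm t ht
    have hs1 : 1 ≤ Real.sqrt t := Real.one_le_sqrt.2 ht
    have : 1 + Real.log (1 + A0) + LL ≤ (1 + Real.log (1 + A0)) * (1 + LL) := by nlinarith [mul_nonneg hlA hll]
    have h5 : (1 + Real.log (1 + A0)) * (1 + LL) ≤ (1 + Real.log (1 + A0)) * (1 + LL) * Real.sqrt t :=
      le_mul_of_one_le_right (by positivity) hs1
    have h6 : 2 * Real.sqrt t ≤ 2 * (1 + LL) * Real.sqrt t := by nlinarith [mul_nonneg hll (by linarith : 0 ≤ Real.sqrt t)]
    linarith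
  have hQG : ∀ m : ℤ, m ≠ 0 → ‖Qf β d h0 N J (G m)‖ ≤ C * ((3 + Real.log (1 + A0)) * (1 + LL) * Real.sqrt |(m:ℝ)|) := by
    intro m hm
    have hm1 : 1 ≤ |(m:ℝ)| := by
      rw [← Int.cast_abs]; exact_mod_cast Int.one_le_abs hm
    have hA : |(m:ℝ)| * A0 ≥ A0 := le_mul_of_one_le_left hA0p.le hm1
    have hee : ∀ y, Real.exp ((y + θ) / d) = Real.exp (θ / d) * Real.exp (1 / d * y) := by
      intro y; rw [← Real.exp_add]; congr 1; ring
    rcases lt_or_gt_of_ne hm with h | h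
    · have : G m = fun y => (starRingEnd ℂ) (ef (|(m:ℝ)| * A0) (1 / d) y) := by
        ext y
        rw [hG]; unfold ef
        simp only
        rw [← Complex.exp_conj, map_mul, Complex.conj_I, Complex.conj_ofReal,
          abs_of_neg (by exact_mod_cast h), hee, hA0]
        congr 1; push_cast; ring
      rw [this, Qf_conj, RCLike.norm_conj]
      refine (b _ (fun n hn => ?_) _ hA N hN J hJ).trans ?_
      · have := hβ (-n) (neg_ne_zero.2 hn)
        rw [Int.cast_neg, abs_neg] at this
        rwa [← RCLike.norm_conj, map_sub, map_one, Complex.conj_conj]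
      · gcongr; exact hbd _ hm1
    · have : G m = ef (|(m:ℝ)| * A0) (1 / d) := by
        ext y
        rw [hG]; unfold ef
        simp only
        rw [abs_of_pos (by exact_mod_cast h), hee, hA0]
        congr 1; push_cast; ring
      rw [this]
      refine (b _ hβ _ hA N hN J hJ).trans ?_
      gcongr; exact hbd _ hm1
  have fin : ‖K * Qf β d h0 N J (fun y => (bernoulliFun k (Int.fract (Real.exp ((y + θ) / d))) : ℂ))‖ ≤
      (C * (3 + Real.log (1 + A0)) * (1 + LL)) * Z := by
    rw [← hQ.tsum_eq]
    refine tsum_of_norm_bounded (hs.hasSum.mul_left _) fun m => ?_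
    rcases eq_or_ne m 0 with rfl | hm
    · rw [Int.cast_zero, zero_pow (by omega)]
      simp
    have hm1 : 1 ≤ |(m:ℝ)| := by
      rw [← Int.cast_abs]; exact_mod_cast Int.one_le_abs hm
    have hnp : 0 < |(m:ℝ)| := by linarith
    rw [norm_mul, norm_div, norm_one, norm_pow, Complex.norm_intCast]
    calc 1 / |(m:ℝ)| ^ k * ‖Qf β d h0 N J (G m)‖
        ≤ 1 / |(m:ℝ)| ^ 2 * (C * ((3 + Real.log (1 + A0)) * (1 + LL) * Real.sqrt |(m:ℝ)|)) := by
          gcongr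
          exact hQG m hm
      _ = (C * (3 + Real.log (1 + A0)) * (1 + LL)) * (Real.sqrt |(m:ℝ)| / |(m:ℝ)| ^ 2) := by ring
      _ = _ := by
        congr 1
        rw [Real.sqrt_eq_rpow, ← Real.rpow_natCast, ← Real.rpow_sub hnp]
        norm_num
  rw [norm_mul] at fin
  have hKp : 0 < ‖K‖ := norm_pos_iff.2 hK0
  calc _ = ‖K‖⁻¹ * (‖K‖ * ‖Qf β d h0 N J (fun y => (bernoulliFun k (Int.fract (Real.exp ((y + θ) / d))) : ℂ))‖) := by
        field_simp
    _ ≤ ‖K‖⁻¹ * ((C * (3 + Real.log (1 + A0)) * (1 + LL)) * Z) := by gcongr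
    _ ≤ _ := by nlinarith

end S6

section S7
open MeasureTheory intervalIntegral Set Filter Topology

noncomputable def pb (j : ℕ) (x : ℝ) : ℝ := bernoulliFun j (Int.fract x)

lemma pb_meas (j : ℕ) : Measurable (pb j) :=
  (continuous_bernoulliFun j).measurable.comp measurable_fract

lemma pb_bdd (j : ℕ) : ∃ M, ∀ x, ‖(pb j x : ℂ)‖ ≤ M := by
  obtain ⟨M, hM⟩ := (isCompact_Icc (a := (0:ℝ)) (b := 1)).exists_bound_of_continuousOn
    (continuous_bernoulliFun j).continuousOn
  refine ⟨M, fun x => ?_⟩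
  rw [Complex.norm_real]
  exact hM _ ⟨Int.fract_nonneg x, (Int.fract_lt_one x).le⟩

lemma pb_cont {j : ℕ} (hj : j ≠ 1) : Continuous (pb j) :=
  ContinuousOn.comp_fract'' (continuous_bernoulliFun j).continuousOn
    (bernoulliFun_endpoints_eq_of_ne_one hj).symm

lemma pb_deriv (j : ℕ) {x : ℝ} (hx : x ∉ Set.range ((↑) : ℤ → ℝ)) :
    HasDerivAt (pb (j + 1)) ((j + 1) * pb j x) x := by
  have hf : (fun y => y - (⌊x⌋ : ℝ)) =ᶠ[𝓝 x] Int.fract := by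
    have h1 : (⌊x⌋ : ℝ) < x := lt_of_le_of_ne (Int.floor_le x) (fun h => hx ⟨_, h⟩)
    have h2 : x < ⌊x⌋ + 1 := Int.lt_floor_add_one x
    filter_upwards [Ioo_mem_nhds h1 h2] with y hy
    have : ⌊y⌋ = ⌊x⌋ := Int.floor_eq_iff.2 ⟨hy.1.le, hy.2⟩
    rw [← Int.self_sub_floor, this]
  have h3 : HasDerivAt Int.fract 1 x := ((hasDerivAt_id x).sub_const (⌊x⌋ : ℝ)).congr_of_eventuallyEq hf.symm
  have := (hasDerivAt_bernoulliFun (j + 1) (Int.fract x)).comp x h3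
  simpa [pb, Function.comp_def] using! this

lemma cpow_cont (w : ℂ) {a X : ℝ} (ha : 0 < a) (hX : 0 < X) :
    ContinuousOn (fun x : ℝ => (x:ℂ) ^ w) (uIcc a X) := by
  intro x hx
  have : 0 < x := (lt_min ha hX).trans_le hx.1
  exact (Complex.continuousAt_ofReal_cpow_const _ _ (Or.inr this.ne')).continuousWithinAt

lemma pb_ii (j : ℕ) (w : ℂ) {a X : ℝ} (ha : 0 < a) (hX : 0 < X) :
    IntervalIntegrable (fun x => (pb j x : ℂ) * (x:ℂ) ^ w) volume a X := by
  refine IntervalIntegrable.mul_continuousOn ?_ (cpow_cont w ha hX)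
  obtain ⟨M, hM⟩ := pb_bdd j
  exact (intervalIntegrable_const (c := M)).mono_fun'
    (Complex.measurable_ofReal.comp (pb_meas j)).aestronglyMeasurable (Eventually.of_forall hM)

lemma pb_io (j : ℕ) {w : ℂ} (hw : w.re < -1) {a : ℝ} (ha : 0 < a) :
    IntegrableOn (fun x => (pb j x : ℂ) * (x:ℂ) ^ w) (Ioi a) := by
  obtain ⟨M, hM⟩ := pb_bdd j
  exact (integrableOn_Ioi_cpow_of_lt hw ha).bdd_mul (c := M)
    (Complex.measurable_ofReal.comp (pb_meas j)).aestronglyMeasurable (Eventually.of_forall hM)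

lemma pb_parts {j : ℕ} (hj : 1 ≤ j) (w : ℂ) {a X : ℝ} (ha : 0 < a) (hX : 0 < X) :
    ∫ x in a..X, (pb j x : ℂ) * (x:ℂ) ^ w =
      ((pb (j+1) X : ℂ) * (X:ℂ) ^ w - (pb (j+1) a : ℂ) * (a:ℂ) ^ w) / (j + 1) -
        w / (j + 1) * ∫ x in a..X, (pb (j+1) x : ℂ) * (x:ℂ) ^ (w - 1) := by
  have i1 := pb_ii j w ha hX
  have i2 := pb_ii (j+1) (w-1) ha hX
  have hj0 : ((j:ℂ) + 1) ≠ 0 := by exact_mod_cast Nat.succ_ne_zero j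
  have := integral_eq_of_hasDerivAt_off_countable
    (fun x : ℝ => (pb (j+1) x : ℂ) * (x:ℂ) ^ w)
    (fun x : ℝ => ((j:ℂ) + 1) * ((pb j x : ℂ) * (x:ℂ) ^ w) + w * ((pb (j+1) x : ℂ) * (x:ℂ) ^ (w - 1)))
    (a := a) (b := X) (Set.countable_range ((↑) : ℤ → ℝ))
    ((Complex.continuous_ofReal.comp (pb_cont (by omega))).continuousOn.mul (cpow_cont w ha hX))
    (fun x hx => by
      have hx0 : 0 < x := (lt_min ha hX).trans hx.1.1
      have d1 := (pb_deriv j hx.2).ofReal_comp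
      have d2 : HasDerivAt (fun x : ℝ => (x:ℂ) ^ w) (w * (x:ℂ) ^ (w - 1)) x := by
        have := (hasDerivAt_id (x:ℂ)).cpow_const (c := w) (Or.inl (by simpa using hx0))
        simpa using this.comp_ofReal
      convert! d1.mul d2 using 1
      push_cast; ring)
    ((i1.const_mul _).add (i2.const_mul _))
  rw [intervalIntegral.integral_add (i1.const_mul _) (i2.const_mul _), intervalIntegral.integral_const_mul,
    intervalIntegral.integral_const_mul] at this
  rw [← this]
  field_simp
  ring

lemma pb_tendsto {j : ℕ} (hj : 1 ≤ j) {w : ℂ} (hw : w.re < 0) {a : ℝ} (ha : 0 < a) :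
    Tendsto (fun X : ℝ => ∫ x in a..X, (pb j x : ℂ) * (x:ℂ) ^ w) atTop
      (𝓝 (-((pb (j+1) a : ℂ) * (a:ℂ) ^ w) / (j + 1) -
        w / (j + 1) * ∫ x in Ioi a, (pb (j+1) x : ℂ) * (x:ℂ) ^ (w - 1))) := by
  obtain ⟨M, hM⟩ := pb_bdd (j+1)
  have t1 : Tendsto (fun X : ℝ => (pb (j+1) X : ℂ) * (X:ℂ) ^ w) atTop (𝓝 0) := by
    have h1 : Tendsto (fun X : ℝ => M * X ^ w.re) atTop (𝓝 0) := by
      have := (tendsto_rpow_neg_atTop (y := -w.re) (by linarith)).const_mul M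
      simpa using this
    refine squeeze_zero_norm' ?_ h1
    filter_upwards [eventually_gt_atTop 0] with X hX
    rw [norm_mul, Complex.norm_cpow_eq_rpow_re_of_pos hX]
    gcongr; exact hM X
  have t2 := intervalIntegral_tendsto_integral_Ioi a (pb_io (j+1) (w := w - 1)
    (by simp; linarith) ha) tendsto_id
  have t3 := ((t1.sub_const ((pb (j+1) a : ℂ) * (a:ℂ) ^ w)).div_const ((j:ℂ)+1)).sub
    (t2.const_mul (w / ((j:ℂ) + 1)))
  rw [zero_sub] at t3
  refine t3.congr' ?_
  filter_upwards [eventually_gt_atTop 0] with X hX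
  rw [pb_parts hj w ha hX]; rfl

lemma pb_int {j : ℕ} (hj : 1 ≤ j) {w : ℂ} (hw : w.re < -1) {a : ℝ} (ha : 0 < a) :
    ∫ x in Ioi a, (pb j x : ℂ) * (x:ℂ) ^ w = (-((pb (j+1) a : ℂ) * (a:ℂ) ^ w) / (j + 1) -
        w / (j + 1) * ∫ x in Ioi a, (pb (j+1) x : ℂ) * (x:ℂ) ^ (w - 1)) :=
  tendsto_nhds_unique (intervalIntegral_tendsto_integral_Ioi a (pb_io j hw ha) tendsto_id)
    (pb_tendsto hj (by linarith) ha)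

end S7

section S8
open MeasureTheory intervalIntegral Set Filter Topology

lemma zeta_base {a : ℝ} (ha : 0 < a) (ha1 : a < 1) {s : ℂ} (hs : 1 < s.re) :
    riemannZeta s = s * (a:ℂ) ^ (1 - s) / (s - 1) + (a:ℂ) ^ (-s) * (-(1/2)) -
      s * ∫ x in Ioi a, (pb 1 x : ℂ) * (x:ℂ) ^ (-s - 1) := by
  have hs0 : s ≠ 0 := by rintro rfl; simp at hs; linarith
  have hs1 : s - 1 ≠ 0 := by
    intro h; rw [sub_eq_zero] at h; rw [h] at hs; simp at hs
  have h1 := LSeries_eq_mul_integral_of_nonneg (fun _ => 1) (r := 1) (s := s) (by norm_num) hs (by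
    simp only [Finset.sum_const, Nat.card_Icc, add_tsub_cancel_right, nsmul_eq_mul, mul_one, Real.rpow_one]
    exact Asymptotics.isBigO_refl _ _) (fun _ => by norm_num)
  have h2 : riemannZeta s = LSeries (fun _ => ((1:ℝ):ℂ)) s := by
    rw [← LSeries_one_eq_riemannZeta hs]; congr 1
  rw [h2, h1]
  have e1 : ∫ t in Ioi (1:ℝ), (∑ k ∈ Finset.Icc 1 ⌊t⌋₊, ((1:ℝ):ℂ)) * (t:ℂ) ^ (-(s + 1)) =
      ∫ t in Ioi a, ((t:ℂ) ^ (-s) - (1/2) * (t:ℂ) ^ (-s - 1) - (pb 1 t : ℂ) * (t:ℂ) ^ (-s - 1)) := by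
    rw [← integral_Ici_eq_integral_Ioi]
    have hfl : ∀ t ∈ Ioi a, (∑ k ∈ Finset.Icc 1 ⌊t⌋₊, ((1:ℝ):ℂ)) * (t:ℂ) ^ (-(s + 1)) =
        ((t:ℂ) ^ (-s) - (1/2) * (t:ℂ) ^ (-s - 1) - (pb 1 t : ℂ) * (t:ℂ) ^ (-s - 1)) := by
      intro t ht
      have ht0 : 0 < t := ha.trans ht
      have htc : (t:ℂ) ≠ 0 := by exact_mod_cast ht0.ne'
      simp only [Finset.sum_const, Nat.card_Icc, add_tsub_cancel_right, nsmul_eq_mul, Complex.ofReal_one, mul_one]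
      have e2 : (t:ℂ) ^ (-s) = t * (t:ℂ) ^ (-s - 1) := by
        rw [Complex.cpow_sub _ _ htc, Complex.cpow_one]; field_simp
      have e3 : (⌊t⌋₊ : ℂ) = t - 1/2 - pb 1 t := by
        unfold pb
        rw [bernoulliFun_one, ← Int.self_sub_floor, ← natCast_floor_eq_intCast_floor ht0.le]
        push_cast; ring
      rw [e2, e3, show -(s+1) = -s - 1 by ring]; ring
    rw [← setIntegral_congr_fun measurableSet_Ioi hfl]
    symm
    refine setIntegral_eq_of_subset_of_forall_sdiff_eq_zero measurableSet_Ioi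
      (fun x hx => ha1.trans_le hx) (fun x hx => ?_)
    have : ⌊x⌋₊ = 0 := Nat.floor_eq_zero.2 (not_le.1 hx.2)
    rw [this]; simp
  have i1 : IntegrableOn (fun t : ℝ => (t:ℂ) ^ (-s)) (Ioi a) :=
    integrableOn_Ioi_cpow_of_lt (by simp; linarith) ha
  have i2 : IntegrableOn (fun t : ℝ => (t:ℂ) ^ (-s-1)) (Ioi a) :=
    integrableOn_Ioi_cpow_of_lt (by simp; linarith) ha
  have i3 := pb_io 1 (w := -s-1) (by simp; linarith) ha
  have i4 : IntegrableOn (fun t : ℝ => (t:ℂ) ^ (-s) - (1/2) * (t:ℂ) ^ (-s-1)) (Ioi a) :=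
    i1.sub (i2.const_mul _)
  rw [e1, integral_sub i4 i3, integral_sub i1 (i2.const_mul _), MeasureTheory.integral_const_mul,
    integral_Ioi_cpow_of_lt (by simp; linarith) ha, integral_Ioi_cpow_of_lt (by simp; linarith) ha,
    show -s - 1 + 1 = -s by ring, show -s + 1 = 1 - s by ring, mul_sub, mul_sub]
  congr 1
  have : 1 - s ≠ 0 := by rw [← neg_sub]; exact neg_ne_zero.2 hs1
  rw [show 1 - s = -(s - 1) by ring]
  field_simp
  ring

lemma zeta_EM {a : ℝ} (ha : 0 < a) (ha1 : a < 1) (j : ℕ) : ∃ p : Polynomial ℂ, p.natDegree ≤ j ∧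
    ∀ s : ℂ, 1 < s.re → riemannZeta s = s * (a:ℂ) ^ (1 - s) / (s - 1) + (a:ℂ) ^ (-s) * p.eval s -
      (ascPochhammer ℂ (j+1)).eval s / (Nat.factorial (j+1)) *
        ∫ x in Ioi a, (pb (j+1) x : ℂ) * (x:ℂ) ^ (-s - (j+1)) := by
  have hac : (a:ℂ) ≠ 0 := by exact_mod_cast ha.ne'
  induction j with
  | zero =>
    refine ⟨Polynomial.C (-(1/2)), by simp, fun s hs => ?_⟩
    rw [zeta_base ha ha1 hs]
    simp
  | succ j ih =>
    obtain ⟨p, hp, h⟩ := ih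
    refine ⟨p + Polynomial.C ((pb (j+2) a : ℂ) * ((a:ℂ) ^ (j+1))⁻¹ / (Nat.factorial (j+2))) * ascPochhammer ℂ (j+1),
      ?_, fun s hs => ?_⟩
    · refine (Polynomial.natDegree_add_le _ _).trans (max_le (hp.trans (Nat.le_succ j)) ?_)
      refine (Polynomial.natDegree_C_mul_le _ _).trans ?_
      rw [ascPochhammer_natDegree]
    · rw [h s hs, pb_int (j := j+1) (by omega) (by simp; linarith [(j.cast_nonneg : (0:ℝ) ≤ j)]) ha,
        ascPochhammer_succ_right ℂ (j+1), Nat.factorial_succ (j+1)]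
      have e1 : (a:ℂ) ^ (-s - ((j:ℂ) + 1)) = (a:ℂ) ^ (-s) * ((a:ℂ) ^ (j+1))⁻¹ := by
        rw [Complex.cpow_sub _ _ hac, ← Complex.cpow_natCast, div_eq_mul_inv]; push_cast; rfl
      have e2 : -s - ((j:ℂ) + 1) - 1 = -s - (((j+1:ℕ):ℂ) + 1) := by push_cast; ring
      rw [e1, e2]
      simp only [Polynomial.eval_add, Polynomial.eval_mul, Polynomial.eval_C, Polynomial.eval_X, Polynomial.eval_natCast]
      have hf : (Nat.factorial (j+1) : ℂ) ≠ 0 := by exact_mod_cast Nat.factorial_ne_zero _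
      have hj : ((j:ℂ) + 1 + 1) ≠ 0 := by exact_mod_cast Nat.succ_ne_zero (j+1)
      push_cast
      field_simp
      ring

lemma pbI_diff (j : ℕ) {a : ℝ} (ha : 0 < a) {w : ℂ} (hw : w.re < 0) :
    DifferentiableAt ℂ (fun w : ℂ => ∫ x in Ioi a, (pb j x : ℂ) * (x:ℂ) ^ (w - 1)) w := by
  set f : ℝ → ℂ := (Ioi a).indicator (fun x => (pb j x : ℂ)) with hf
  obtain ⟨M, hM⟩ := pb_bdd j
  have hfb : ∀ x, ‖f x‖ ≤ M := fun x => by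
    rw [hf]; exact (norm_indicator_le_norm_self _ _).trans (hM x)
  have hfm : Measurable f := (Complex.measurable_ofReal.comp (pb_meas j)).indicator measurableSet_Ioi
  have e : (fun w : ℂ => ∫ x in Ioi a, (pb j x : ℂ) * (x:ℂ) ^ (w - 1)) = mellin f := by
    ext w
    unfold mellin
    have : ∀ t : ℝ, (t:ℂ) ^ (w - 1) • f t = (Ioi a).indicator (fun x : ℝ => (pb j x : ℂ) * (x:ℂ) ^ (w - 1)) t := by
      intro t
      rw [hf]
      by_cases ht : t ∈ Ioi a
      · rw [indicator_of_mem ht, indicator_of_mem ht, smul_eq_mul, mul_comm]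
      · rw [indicator_of_notMem ht, indicator_of_notMem ht, smul_zero]
    simp_rw [this]
    rw [setIntegral_indicator measurableSet_Ioi, inter_eq_right.2 (Ioi_subset_Ioi ha.le)]
  rw [e]
  refine mellin_differentiableAt_of_isBigO_rpow (a := 0) (b := w.re - 1) ?_ ?_ hw ?_ (by linarith)
  · apply LocallyIntegrable.locallyIntegrableOn
    intro x
    refine ⟨Icc (x-1) (x+1), Icc_mem_nhds (by linarith) (by linarith), ?_⟩
    exact Measure.integrableOn_of_bounded (M := M) (by simp) hfm.aestronglyMeasurable
      (Eventually.of_forall hfb)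
  · rw [Asymptotics.isBigO_iff]
    refine ⟨M, Eventually.of_forall fun x => ?_⟩
    simpa using hfb x
  · have : f =ᶠ[𝓝[>] 0] fun _ => 0 := by
      filter_upwards [Ioo_mem_nhdsGT ha] with x hx
      rw [hf, indicator_of_notMem (by simpa using hx.2.le)]
    exact this.trans_isBigO (Asymptotics.isBigO_zero _ _)

lemma zeta_cont {a : ℝ} (ha : 0 < a) (ha1 : a < 1) (k : ℕ) : ∃ p : Polynomial ℂ, p.natDegree ≤ k ∧
    ∀ s : ℂ, -(k+1) < s.re → s.im ≠ 0 →
      Tendsto (fun X : ℝ => s * (a:ℂ) ^ (1 - s) / (s - 1) + (a:ℂ) ^ (-s) * p.eval s -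
      (ascPochhammer ℂ (k+1)).eval s / (Nat.factorial (k+1)) *
        ∫ x in a..X, (pb (k+1) x : ℂ) * (x:ℂ) ^ (-s - (k+1))) atTop (𝓝 (riemannZeta s)) := by
  obtain ⟨p, hp, h⟩ := zeta_EM ha ha1 k
  have hac : (a:ℂ) ≠ 0 := by exact_mod_cast ha.ne'
  refine ⟨p, hp, fun s0 hs0 hs0' => ?_⟩
  set g : ℂ → ℂ := fun s => s * (a:ℂ) ^ (1 - s) / (s - 1) + (a:ℂ) ^ (-s) * p.eval s -
      (ascPochhammer ℂ (k+1)).eval s / (Nat.factorial (k+1)) *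
      (-((pb (k+1+1) a : ℂ) * (a:ℂ) ^ (-s - (k+1))) / (((k+1 : ℕ):ℂ) + 1) -
        (-s - (k+1)) / (((k+1 : ℕ):ℂ) + 1) * ∫ x in Ioi a, (pb (k+1+1) x : ℂ) * (x:ℂ) ^ ((-s - (k+1)) - 1)) with hg
  set U : Set ℂ := {s | -((k:ℝ)+1) < s.re} ∩ {s | 0 < s0.im * s.im} with hU
  have hUo : IsOpen U := (isOpen_lt continuous_const Complex.continuous_re).inter
    (isOpen_lt continuous_const (continuous_const.mul Complex.continuous_im))
  have hUc : Convex ℝ U := by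
    apply Convex.inter
    · exact convex_halfSpace_re_gt _
    · exact convex_halfSpace_gt (f := fun s : ℂ => s0.im * s.im)
        ⟨fun x y => by simp; ring, fun c x => by simp; ring⟩ 0
  have hne : ∀ s ∈ U, s ≠ 1 := by
    rintro s hs rfl
    have := hs.2
    simp at this
  have hs0U : s0 ∈ U := ⟨hs0, by have := sq_pos_of_ne_zero hs0'; simp only [mem_ofPred_eq]; nlinarith⟩
  have hgd : DifferentiableOn ℂ g U := by
    intro s hs
    apply DifferentiableAt.differentiableWithinAt
    have hsne := sub_ne_zero.2 (hne s hs)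
    have d1 : ∀ c : ℂ, DifferentiableAt ℂ (fun s : ℂ => (a:ℂ) ^ (c - s)) s := fun c =>
      ((differentiableAt_const c).sub differentiableAt_id).const_cpow (Or.inl hac)
    have d2 : DifferentiableAt ℂ (fun s : ℂ => (a:ℂ) ^ (-s)) s := by simpa using d1 0
    have d3 : DifferentiableAt ℂ (fun s : ℂ => (a:ℂ) ^ (-s - (k+1))) s := by
      have := d1 (-(k+1)); refine this.congr_of_eventuallyEq (Eventually.of_forall fun x => ?_)
      simp only; congr 1; ring
    have d4 : DifferentiableAt ℂ (fun s : ℂ => ∫ x in Ioi a, (pb (k+1+1) x : ℂ) * (x:ℂ) ^ ((-s - (k+1)) - 1)) s := by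
      have hw : (-s - (k+1)).re < 0 := by
        have : -((k:ℝ)+1) < s.re := hs.1
        simp; linarith
      exact DifferentiableAt.comp (f := fun s : ℂ => -s - (k+1)) s (pbI_diff (k+1+1) ha hw) (by fun_prop)
    have d5 := (p.differentiable).differentiableAt (x := s)
    have d6 := ((ascPochhammer ℂ (k+1)).differentiable).differentiableAt (x := s)
    have d7 := d1 1
    rw [hg]
    refine DifferentiableAt.sub (DifferentiableAt.add (DifferentiableAt.div (by fun_prop) (by fun_prop) hsne) (by fun_prop)) ?_
    refine DifferentiableAt.mul (by fun_prop) (DifferentiableAt.sub (by fun_prop) ?_)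
    exact DifferentiableAt.mul (by fun_prop) d4
  have hzd : DifferentiableOn ℂ riemannZeta U := fun s hs =>
    (differentiableAt_riemannZeta (hne s hs)).differentiableWithinAt
  have hz1 : (⟨2, s0.im⟩ : ℂ) ∈ U := by
    refine ⟨?_, ?_⟩
    · simp only [mem_ofPred_eq]; linarith [(k.cast_nonneg : (0:ℝ) ≤ k)]
    · have := sq_pos_of_ne_zero hs0'; simp only [mem_ofPred_eq]; nlinarith
  have hev : riemannZeta =ᶠ[𝓝 (⟨2, s0.im⟩ : ℂ)] g := by
    filter_upwards [(isOpen_lt continuous_const Complex.continuous_re).mem_nhds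
      (show (1:ℝ) < (⟨2, s0.im⟩ : ℂ).re by norm_num)] with s hs
    have hs : 1 < s.re := hs
    rw [h s hs, pb_int (j := k+1) (by omega) (by simp; linarith [(k.cast_nonneg : (0:ℝ) ≤ k)]) ha]
  have heq := (hzd.analyticOnNhd hUo).eqOn_of_preconnected_of_eventuallyEq (hgd.analyticOnNhd hUo)
    hUc.isPreconnected hz1 hev hs0U
  rw [heq]
  have t := pb_tendsto (j := k+1) (by omega) (w := -s0 - (k+1)) (by simp; linarith) ha
  exact tendsto_const_nhds.sub (t.const_mul _)

end S8

section S9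
open MeasureTheory intervalIntegral Set Filter Topology

lemma beta_bd (z0 c : ℂ) (hz : z0 ≠ 0) (K : ℕ) : ∃ B ≥ 0, ∀ n : ℤ, n ≠ 0 →
    ‖(ascPochhammer ℂ K).eval (c + z0 * n) / (z0 * n) ^ K - 1‖ ≤ B / |(n:ℝ)| := by
  induction K with
  | zero => exact ⟨0, le_rfl, fun n _ => by simp⟩
  | succ K ih =>
    obtain ⟨B, hB, h⟩ := ih
    refine ⟨B + (1 + B) * (‖c + K‖ / ‖z0‖), by positivity, fun n hn => ?_⟩
    have hn1 : 1 ≤ |(n:ℝ)| := by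
      rw [← Int.cast_abs]; exact_mod_cast Int.one_le_abs hn
    have hnp : 0 < |(n:ℝ)| := by linarith
    have hnc : (n:ℂ) ≠ 0 := by exact_mod_cast hn
    set f := (ascPochhammer ℂ K).eval (c + z0 * n) / (z0 * n) ^ K with hf
    have e : (ascPochhammer ℂ (K+1)).eval (c + z0 * n) / (z0 * n) ^ (K+1) - 1 =
        (f - 1) + f * ((c + K) / (z0 * n)) := by
      rw [ascPochhammer_succ_right, hf]
      simp only [Polynomial.eval_add, Polynomial.eval_mul, Polynomial.eval_X, Polynomial.eval_natCast]
      field_simp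
      ring
    have hfn : ‖f - 1‖ ≤ B / |(n:ℝ)| := h n hn
    have hf1 : ‖f‖ ≤ 1 + B := by
      have h1 : ‖f‖ ≤ ‖f - 1‖ + ‖(1:ℂ)‖ := by simpa using norm_add_le (f - 1) 1
      rw [norm_one] at h1
      have h2 : B / |(n:ℝ)| ≤ B := div_le_self hB hn1
      linarith
    rw [e]
    refine (norm_add_le _ _).trans ?_
    clear_value f
    rw [norm_mul f, norm_div (c + (K:ℂ)), norm_mul z0, Complex.norm_intCast]
    calc ‖f - 1‖ + ‖f‖ * (‖c + K‖ / (‖z0‖ * |(n:ℝ)|)) ≤ B / |(n:ℝ)| + (1 + B) * (‖c + K‖ / (‖z0‖ * |(n:ℝ)|)) := by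
          gcongr
      _ = _ := by
        have : ‖z0‖ ≠ 0 := norm_ne_zero_iff.2 hz
        field_simp

lemma poly_pair {k : ℕ} (hk : 1 ≤ k) (q : Polynomial ℂ) (hq : q.natDegree ≤ k) (m : ℕ) (hm : 1 ≤ m) :
    ‖q.eval (m:ℂ) / (m:ℂ) ^ (k+1) + q.eval (-(m:ℂ)) / (-(m:ℂ)) ^ (k+1)‖ ≤
      2 * (∑ i ∈ Finset.range (k+1), ‖q.coeff i‖) * (1 / (m:ℝ) ^ 2) := by
  have hmc : (m:ℂ) ≠ 0 := by exact_mod_cast (by omega : m ≠ 0)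
  have hmr : (1:ℝ) ≤ m := by exact_mod_cast hm
  rw [Polynomial.eval_eq_sum_range' (Nat.lt_succ_of_le hq), Polynomial.eval_eq_sum_range' (Nat.lt_succ_of_le hq),
    Finset.sum_div, Finset.sum_div, ← Finset.sum_add_distrib, Finset.mul_sum, Finset.sum_mul]
  refine (norm_sum_le _ _).trans (Finset.sum_le_sum fun i hi => ?_)
  have hi' : i ≤ k := by rw [Finset.mem_range] at hi; omega
  rcases hi'.eq_or_lt with h | h
  · have : q.coeff i * (m:ℂ) ^ i / (m:ℂ) ^ (k + 1) + q.coeff i * (-(m:ℂ)) ^ i / (-(m:ℂ)) ^ (k + 1) = 0 := by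
      rw [h]
      have h2 : (-(m:ℂ)) ≠ 0 := neg_ne_zero.2 hmc
      have h3 : (m:ℂ)^k ≠ 0 := pow_ne_zero _ hmc
      have h4 : (-(m:ℂ))^k ≠ 0 := pow_ne_zero _ h2
      rw [mul_div_assoc, mul_div_assoc, pow_succ (m:ℂ), pow_succ (-(m:ℂ)), ← div_div, ← div_div, div_self h3,
        div_self h4, div_neg]
      ring
    rw [this, norm_zero]; positivity
  · have hb : ‖(m:ℂ) ^ i / (m:ℂ) ^ (k+1)‖ ≤ 1 / (m:ℝ)^2 := by
      rw [norm_div, norm_pow, norm_pow, Complex.norm_natCast, div_le_div_iff₀ (by positivity) (by positivity),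
        one_mul, ← pow_add]
      exact pow_le_pow_right₀ hmr (by omega)
    have hb2 : ‖(-(m:ℂ)) ^ i / (-(m:ℂ)) ^ (k+1)‖ ≤ 1 / (m:ℝ)^2 := by
      rw [norm_div, norm_pow, norm_pow, norm_neg, ← norm_pow, ← norm_pow, ← norm_div]; exact hb
    refine (norm_add_le _ _).trans ?_
    rw [mul_div_assoc, mul_div_assoc, norm_mul, norm_mul]
    nlinarith [norm_nonneg (q.coeff i), mul_le_mul_of_nonneg_left hb (norm_nonneg (q.coeff i)),
      mul_le_mul_of_nonneg_left hb2 (norm_nonneg (q.coeff i))]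

lemma sum_sq_bd : ∃ Z > 0, ∀ N : ℕ, ∑ n ∈ Finset.range N, 1 / ((n+1 : ℕ):ℝ) ^ 2 ≤ Z := by
  have h : Summable fun n : ℕ => 1 / ((n+1 : ℕ):ℝ) ^ 2 :=
    (summable_nat_add_iff 1 (f := fun n : ℕ => 1 / (n:ℝ) ^ 2)).2 (Real.summable_one_div_nat_pow.2 (by norm_num))
  refine ⟨(∑' n : ℕ, 1 / ((n+1 : ℕ):ℝ) ^ 2) + 1, ?_, fun N => ?_⟩
  · have : 0 ≤ ∑' n : ℕ, 1 / ((n+1 : ℕ):ℝ) ^ 2 := tsum_nonneg fun n => by positivity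
    linarith
  · have := h.sum_le_tsum (Finset.range N) (fun i _ => by positivity)
    linarith

lemma poly_sum {k : ℕ} (hk : 1 ≤ k) (p : Polynomial ℂ) (hp : p.natDegree ≤ k) (z0 : ℂ) (a : ℝ) (hz0 : z0.re = 0) :
    ∃ C > 0, ∀ N : ℕ, ‖∑ n ∈ (Finset.Icc (-(N:ℤ)) N).erase 0,
      (-1:ℂ) ^ n * ((-(k:ℂ) + z0 * n) * a / (-(k:ℂ) + z0 * n - 1) + p.eval (-(k:ℂ) + z0 * n)) / (n:ℂ) ^ (k+1)‖ ≤ C := by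
  obtain ⟨Z, hZ, hZs⟩ := sum_sq_bd
  set q := p.comp (Polynomial.C z0 * Polynomial.X + Polynomial.C (-(k:ℂ))) with hq
  have hqd : q.natDegree ≤ k := by
    rw [hq]
    refine Polynomial.natDegree_comp_le.trans ?_
    calc _ ≤ k * 1 := Nat.mul_le_mul hp (Polynomial.natDegree_linear_le)
      _ = k := mul_one k
  have hqe : ∀ x : ℂ, q.eval x = p.eval (-(k:ℂ) + z0 * x) := by
    intro x; rw [hq, Polynomial.eval_comp]; simp [add_comm]
  set S := ∑ i ∈ Finset.range (k+1), ‖q.coeff i‖ with hS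
  have hS0 : 0 ≤ S := Finset.sum_nonneg fun i _ => norm_nonneg _
  refine ⟨(4 * |a| + 2 * S + 1) * Z, by positivity, fun N => ?_⟩
  rw [sum_pm]
  refine (norm_sum_le _ _).trans (le_trans ?_ (mul_le_mul_of_nonneg_left (hZs N) (by positivity)))
  rw [Finset.mul_sum]
  refine Finset.sum_le_sum fun n _ => ?_
  have hm : 1 ≤ n + 1 := by omega
  set m := n + 1 with hmd
  have hmr : (1:ℝ) ≤ m := by exact_mod_cast hm
  have ec : ((n:ℤ) + 1) = (m:ℤ) := by rw [hmd]; push_cast; ring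
  rw [ec]
  have e1 : (-1:ℂ) ^ (-(m:ℤ)) = (-1:ℂ)^m := by
    rw [zpow_neg, zpow_natCast, ← inv_pow]; norm_num
  have e2 : (-1:ℂ) ^ ((m:ℤ)) = (-1:ℂ)^m := zpow_natCast _ _
  rw [e1, e2]
  push_cast
  rw [← hqe, ← hqe]
  have hr : ∀ x : ℝ, ‖(-(k:ℂ) + z0 * x) * a / (-(k:ℂ) + z0 * x - 1)‖ ≤ 2 * |a| := by
    intro x
    have h1 : 1 ≤ ‖-(k:ℂ) + z0 * x - 1‖ := by
      refine le_trans ?_ (Complex.abs_re_le_norm _)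
      have : (-(k:ℂ) + z0 * x - 1).re = -((k:ℝ) + 1) := by simp [hz0]; ring
      rw [this, abs_neg, abs_of_nonneg (by positivity)]
      linarith [(k.cast_nonneg : (0:ℝ) ≤ k)]
    rw [norm_div, norm_mul, Complex.norm_real, Real.norm_eq_abs, div_le_iff₀ (by linarith)]
    have h2 : ‖-(k:ℂ) + z0 * x‖ ≤ ‖-(k:ℂ) + z0 * x - 1‖ + 1 := by
      simpa using norm_add_le (-(k:ℂ) + z0 * x - 1) 1
    nlinarith [abs_nonneg a]
  have hb : ‖1 / (m:ℂ) ^ (k+1)‖ ≤ 1 / (m:ℝ)^2 := by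
    rw [norm_div, norm_one, norm_pow, Complex.norm_natCast]
    exact one_div_le_one_div_of_le (by positivity) (pow_le_pow_right₀ hmr (by omega))
  have hb2 : ‖1 / (-(m:ℂ)) ^ (k+1)‖ ≤ 1 / (m:ℝ)^2 := by
    rw [norm_div, norm_pow, norm_neg, ← norm_pow, ← norm_div]; exact hb
  have hr1 := hr m
  have hr2 := hr (-m)
  push_cast at hr1 hr2
  have hpp := poly_pair hk q hqd m hm
  set A := (-(k:ℂ) + z0 * m) * a / (-(k:ℂ) + z0 * m - 1)
  set A' := (-(k:ℂ) + z0 * -m) * a / (-(k:ℂ) + z0 * -m - 1)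
  have e3 : (-1:ℂ)^m * (A + q.eval (m:ℂ)) / (m:ℂ)^(k+1) + (-1:ℂ)^m * (A' + q.eval (-(m:ℂ))) / (-(m:ℂ))^(k+1) =
      (-1:ℂ)^m * (A * (1 / (m:ℂ)^(k+1)) + A' * (1 / (-(m:ℂ))^(k+1)) +
        (q.eval (m:ℂ) / (m:ℂ) ^ (k+1) + q.eval (-(m:ℂ)) / (-(m:ℂ)) ^ (k+1))) := by ring
  rw [e3, norm_mul, norm_pow, norm_neg, norm_one, one_pow, one_mul]
  have u1 : ‖A * (1 / (m:ℂ)^(k+1))‖ ≤ 2 * |a| * (1 / (m:ℝ)^2) := by rw [norm_mul]; gcongr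
  have u2 : ‖A' * (1 / (-(m:ℂ))^(k+1))‖ ≤ 2 * |a| * (1 / (m:ℝ)^2) := by rw [norm_mul]; gcongr
  refine (norm_add_le _ _).trans ((add_le_add ((norm_add_le _ _).trans (add_le_add u1 u2)) hpp).trans ?_)
  have : 0 ≤ 1 / (m:ℝ)^2 := by positivity
  rw [← hS]
  nlinarith

lemma subst_int {k : ℕ} (hk : 1 ≤ k) {d : ℝ} (hd : 0 < d) (θ α b : ℝ) (n : ℤ) :
    ∫ x in (Real.exp ((α + θ) / d))..(Real.exp ((b + θ) / d)), (pb (k+1) x : ℂ) *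
      (x:ℂ) ^ (-(-(k:ℂ) + 2 * (Real.pi : ℂ) * Complex.I * (d : ℂ) * (n : ℂ)) - (k+1)) =
    (1 / (d:ℂ)) * Complex.exp (-(2 * (Real.pi : ℂ) * Complex.I * (θ : ℂ) * (n : ℂ))) *
      ∫ y in α..b, (pb (k+1) (Real.exp ((y + θ) / d)) : ℂ) *
        Complex.exp (Complex.I * ((-(2 * Real.pi * n) * y : ℝ) : ℂ)) := by
  have hdc : (d:ℂ) ≠ 0 := by exact_mod_cast hd.ne'
  have h := intervalIntegral.integral_deriv_smul_comp'' (a := α) (b := b)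
    (f := fun y => Real.exp ((y + θ) / d)) (f' := fun y => Real.exp ((y + θ) / d) * (1 / d))
    (g := fun x : ℝ => (pb (k+1) x : ℂ) *
      (x:ℂ) ^ (-(-(k:ℂ) + 2 * (Real.pi : ℂ) * Complex.I * (d : ℂ) * (n : ℂ)) - (k+1)))
    (by fun_prop)
    (fun x _ => by
      have : HasDerivAt (fun y => (y + θ) / d) (1 / d) x := ((hasDerivAt_id x).add_const θ).div_const d
      exact this.exp.hasDerivWithinAt)
    (by fun_prop)
    (by
      refine ContinuousOn.mul (Complex.continuous_ofReal.comp (pb_cont (by omega))).continuousOn ?_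
      rintro x ⟨y, _, rfl⟩
      exact (Complex.continuousAt_ofReal_cpow_const _ _ (Or.inr (Real.exp_pos _).ne')).continuousWithinAt)
  rw [← h, ← intervalIntegral.integral_const_mul]
  congr 1; ext y
  simp only [Function.comp_def, Complex.real_smul]
  rw [Complex.cpow_def_of_ne_zero (by exact_mod_cast (Real.exp_pos _).ne'), ← Complex.ofReal_log (Real.exp_pos _).le,
    Real.log_exp]
  push_cast
  rw [show Complex.exp (((y:ℂ) + θ) / d) * (1 / d) * ((pb (k+1) (Real.exp ((y + θ) / d)) : ℂ) *
    Complex.exp (((y:ℂ) + θ) / d * (-(-(k:ℂ) + 2 * (Real.pi : ℂ) * Complex.I * (d : ℂ) * (n : ℂ)) - (k+1)))) =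
    1 / d * (pb (k+1) (Real.exp ((y + θ) / d)) : ℂ) * (Complex.exp (((y:ℂ) + θ) / d) *
    Complex.exp (((y:ℂ) + θ) / d * (-(-(k:ℂ) + 2 * (Real.pi : ℂ) * Complex.I * (d : ℂ) * (n : ℂ)) - (k+1)))) by ring,
    ← Complex.exp_add]
  rw [show ∀ u v w z : ℂ, u * v * (w * z) = u * w * (v * z) by intros; ring, ← Complex.exp_add]
  congr 2
  field_simp
  ring

end S9

section S10
open MeasureTheory intervalIntegral Set Filter Topology

lemma psiB_pb {k : ℕ} (hk : k ≠ 1) (x : ℝ) : psiB k x = pb k x := by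
  rw [psiB, if_neg hk, pb, bernoulliFun, Polynomial.eval_map_algebraMap]

lemma apow {d : ℝ} (hd : 0 < d) (θ : ℝ) (h0 : ℤ) (k : ℕ) (n : ℤ) :
    ((Real.exp (((h0:ℝ) + 1/2 + θ) / d) : ℝ) : ℂ) ^ (-(-(k:ℂ) + 2 * (Real.pi : ℂ) * Complex.I * (d : ℂ) * (n : ℂ))) *
      Complex.exp (2 * (Real.pi : ℂ) * Complex.I * (θ : ℂ) * (n : ℂ)) =
    ((Real.exp (((h0:ℝ) + 1/2 + θ) / d) : ℝ) : ℂ) ^ k * (-1:ℂ) ^ n := by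
  have hdc : (d:ℂ) ≠ 0 := by exact_mod_cast hd.ne'
  rw [Complex.cpow_def_of_ne_zero (by exact_mod_cast (Real.exp_pos _).ne'), ← Complex.ofReal_log (Real.exp_pos _).le,
    Real.log_exp, Complex.ofReal_exp, ← Complex.exp_nat_mul]
  have e1 : (-1:ℂ) ^ n = Complex.exp (n * (-(Real.pi * Complex.I))) := by
    rw [Complex.exp_int_mul, Complex.exp_neg, Complex.exp_pi_mul_I]; norm_num
  rw [e1, ← Complex.exp_add, ← Complex.exp_add, Complex.exp_eq_exp_iff_exists_int]
  refine ⟨-(h0 * n), ?_⟩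
  push_cast
  field_simp
  ring

lemma term_id {k : ℕ} (hk : 1 ≤ k) {d : ℝ} (hd : 0 < d) (θ : ℝ) (h0 : ℤ) (p : Polynomial ℂ) (J : ℕ) (n : ℤ)
    (hn : n ≠ 0) (a : ℝ) (ha : a = Real.exp (((h0:ℝ) + 1/2 + θ) / d)) (s : ℂ)
    (hs : s = -(k:ℂ) + 2 * (Real.pi : ℂ) * Complex.I * (d : ℂ) * (n : ℂ)) :
    ((Nat.factorial (k + 1) : ℂ) / (2 * (Real.pi : ℂ) * Complex.I) ^ (k + 1)) *
      ((s * (a:ℂ) ^ (1 - s) / (s - 1) + (a:ℂ) ^ (-s) * p.eval s -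
      (ascPochhammer ℂ (k+1)).eval s / (Nat.factorial (k+1)) *
        ∫ x in a..(Real.exp (((h0:ℝ) + 1/2 + J + θ) / d)), (pb (k+1) x : ℂ) * (x:ℂ) ^ (-s - (k+1))) *
        Complex.exp (2 * (Real.pi : ℂ) * Complex.I * (θ : ℂ) * (n : ℂ)) / (n : ℂ) ^ (k + 1)) =
    ((Nat.factorial (k + 1) : ℂ) / (2 * (Real.pi : ℂ) * Complex.I) ^ (k + 1)) * (a:ℂ) ^ k *
      ((-1:ℂ) ^ n * (s * a / (s - 1) + p.eval s) / (n:ℂ) ^ (k+1)) -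
    (d:ℂ) ^ k * ((ascPochhammer ℂ (k+1)).eval s / (2 * (Real.pi : ℂ) * Complex.I * (d : ℂ) * (n : ℂ)) ^ (k+1) *
      ∫ y in ((h0:ℝ) + 1/2)..((h0:ℝ) + 1/2 + J), (pb (k+1) (Real.exp ((y + θ) / d)) : ℂ) *
        Complex.exp (Complex.I * ((-(2 * Real.pi * n) * y : ℝ) : ℂ))) := by
  have hdc : (d:ℂ) ≠ 0 := by exact_mod_cast hd.ne'
  have hnc : (n:ℂ) ≠ 0 := by exact_mod_cast hn
  have hpi : (Real.pi:ℂ) ≠ 0 := by exact_mod_cast Real.pi_ne_zero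
  have hfac : (Nat.factorial (k+1) : ℂ) ≠ 0 := by exact_mod_cast Nat.factorial_ne_zero _
  have hac : (a:ℂ) ≠ 0 := by rw [ha]; exact_mod_cast (Real.exp_pos _).ne'
  have h1 := apow hd θ h0 k n
  rw [← ha, ← hs] at h1
  have h2 := subst_int hk hd θ ((h0:ℝ) + 1/2) ((h0:ℝ) + 1/2 + J) n
  rw [← ha, ← hs] at h2
  rw [h2]
  have h3 : (a:ℂ) ^ (1 - s) = a * (a:ℂ) ^ (-s) := by
    rw [sub_eq_add_neg, Complex.cpow_add _ _ hac, Complex.cpow_one]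
  rw [h3, Complex.exp_neg]
  have hE := Complex.exp_ne_zero (2 * (Real.pi : ℂ) * Complex.I * (θ : ℂ) * (n : ℂ))
  generalize Complex.exp (2 * (Real.pi : ℂ) * Complex.I * (θ : ℂ) * (n : ℂ)) = E at *
  generalize (∫ y in ((h0:ℝ) + 1/2)..((h0:ℝ) + 1/2 + J), (pb (k+1) (Real.exp ((y + θ) / d)) : ℂ) *
        Complex.exp (Complex.I * ((-(2 * Real.pi * n) * y : ℝ) : ℂ))) = Y at *
  generalize (ascPochhammer ℂ (k+1)).eval s = P at *
  generalize p.eval s = V at *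
  generalize (a:ℂ) ^ (-s) = A at *
  generalize (Nat.factorial (k+1) : ℂ) = F at *
  rw [show ∀ K : ℂ, K * (a:ℂ)^k * ((-1:ℂ) ^ n * (s * a / (s - 1) + V) / (n:ℂ) ^ (k+1)) =
    K * (((a:ℂ)^k * (-1:ℂ) ^ n) * (s * a / (s - 1) + V) / (n:ℂ) ^ (k+1)) by intro K; ring, ← h1]
  rw [show ∀ K : ℂ, K * ((s * (a * A) / (s - 1) + A * V - P / F * (1 / d * E⁻¹ * Y)) * E / (n:ℂ)^(k+1)) =
    K * (A * E * (s * a / (s - 1) + V) / (n:ℂ) ^ (k+1)) - K * (P / F * (1 / d * Y)) * (E⁻¹ * E) / (n:ℂ)^(k+1) by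
      intro K; ring, inv_mul_cancel₀ hE]
  congr 1
  rw [mul_pow _ (n:ℂ), mul_pow _ (d:ℂ), pow_succ (d:ℂ)]
  have hI := Complex.I_ne_zero
  have hb : (2 * (Real.pi : ℂ) * Complex.I) ^ (k+1) ≠ 0 := pow_ne_zero _ (by simp [hpi])
  field_simp
end S10

section S11
open MeasureTheory intervalIntegral Set Filter Topology

lemma main_bd (k : ℕ) (hk : 0 < k) (d θ : ℝ) (hd : 0 < d) :
    ∃ C > (0 : ℝ), ∀ N : ℕ, 16 ≤ N →
      ‖((Nat.factorial (k + 1) : ℂ) / (2 * (Real.pi : ℂ) * Complex.I) ^ (k + 1)) *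
            (∑ n ∈ (Finset.Icc (-(N : ℤ)) (N : ℤ)).erase 0,
              riemannZeta (-(k : ℂ) + 2 * (Real.pi : ℂ) * Complex.I * (d : ℂ) * (n : ℂ)) *
                Complex.exp (2 * (Real.pi : ℂ) * Complex.I * (θ : ℂ) * (n : ℂ)) /
                  (n : ℂ) ^ (k + 1))
          - ((-(d ^ k * ∑ h ∈ Finset.Ioo (0 : ℤ) ⌈d * Real.log N⌉,
                psiB (k + 1) (Real.exp (((h : ℝ) + θ) / d))) : ℝ) : ℂ)‖
        ≤ C * (1 + Real.log (Real.log N)) := by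
  obtain ⟨h0, hh0, hh1⟩ : ∃ h0 : ℤ, h0 ≤ 0 ∧ (h0:ℝ) + 1/2 + θ < 0 := by
    refine ⟨min 0 (⌊-θ⌋ - 1), min_le_left _ _, ?_⟩
    have h1 : ((min 0 (⌊-θ⌋ - 1) : ℤ) : ℝ) ≤ ((⌊-θ⌋ - 1 : ℤ) : ℝ) := by exact_mod_cast min_le_right _ _
    push_cast at h1 ⊢
    linarith [Int.floor_le (-θ)]
  obtain ⟨a, ha⟩ : ∃ a, a = Real.exp (((h0:ℝ) + 1/2 + θ) / d) := ⟨_, rfl⟩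
  have ha0 : 0 < a := by rw [ha]; exact Real.exp_pos _
  have ha1 : a < 1 := by rw [ha, Real.exp_lt_one_iff]; exact div_neg_of_neg_of_pos hh1 hd
  obtain ⟨p, hp, hz⟩ := zeta_cont ha0 ha1 k
  set z0 : ℂ := 2 * (Real.pi : ℂ) * Complex.I * (d : ℂ) with hz0
  have hz0' : z0 ≠ 0 := by simp [hz0, hd.ne', Real.pi_ne_zero]
  have hz0r : z0.re = 0 := by simp [hz0]
  have hz0i : z0.im = 2 * Real.pi * d := by simp [hz0]
  obtain ⟨B, hB, hβ⟩ := beta_bd z0 (-(k:ℂ)) hz0' (k+1)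
  obtain ⟨C1, hC1, h1⟩ := poly_sum hk p hp z0 a hz0r
  obtain ⟨C2, hC2, h2⟩ := Qf_psi θ hd hB h0 hh0 (k := k+1) (by omega)
  obtain ⟨K, hK⟩ : ∃ K : ℂ, K = ((Nat.factorial (k + 1) : ℂ) / (2 * (Real.pi : ℂ) * Complex.I) ^ (k + 1)) := ⟨_, rfl⟩
  refine ⟨‖K‖ * a ^ k * C1 + d ^ k * C2, by positivity, fun N hN => ?_⟩
  have hLL : 0 ≤ Real.log (Real.log N) := by
    apply Real.log_nonneg
    rw [Real.le_log_iff_exp_le (by positivity)]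
    have : (16:ℝ) ≤ N := by exact_mod_cast hN
    linarith [Real.exp_one_lt_d9]
  rw [← hK]
  set S := (Finset.Icc (-(N : ℤ)) (N : ℤ)).erase 0 with hS
  set X : ℕ → ℝ := fun J => Real.exp (((h0:ℝ) + 1/2 + J + θ) / d) with hX
  have hXt : Tendsto X atTop atTop := by
    refine Real.tendsto_exp_atTop.comp (Tendsto.atTop_div_const hd ?_)
    exact tendsto_atTop_add_const_right _ _ (tendsto_atTop_add_const_left _ _ tendsto_natCast_atTop_atTop)
  set T : ℕ → ℤ → ℂ := fun J n => ((-(k:ℂ) + z0 * n) * (a:ℂ) ^ (1 - (-(k:ℂ) + z0 * n)) / ((-(k:ℂ) + z0 * n) - 1) +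
      (a:ℂ) ^ (-(-(k:ℂ) + z0 * n)) * p.eval (-(k:ℂ) + z0 * n) -
      (ascPochhammer ℂ (k+1)).eval (-(k:ℂ) + z0 * n) / (Nat.factorial (k+1)) *
        ∫ x in a..(X J), (pb (k+1) x : ℂ) * (x:ℂ) ^ (-(-(k:ℂ) + z0 * n) - (k+1))) with hT
  set G : ℂ := ((-(d ^ k * ∑ h ∈ Finset.Ioo (0 : ℤ) ⌈d * Real.log N⌉,
                psiB (k + 1) (Real.exp (((h : ℝ) + θ) / d))) : ℝ) : ℂ) with hG
  have hTt : ∀ n ∈ S, Tendsto (fun J => T J n) atTop (𝓝 (riemannZeta (-(k:ℂ) + z0 * n))) := by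
    intro n hn
    have hn0 : n ≠ 0 := (Finset.mem_erase.1 hn).1
    refine (hz (-(k:ℂ) + z0 * n) ?_ ?_).comp hXt
    · simp [hz0r]
    · have : (n:ℝ) ≠ 0 := by exact_mod_cast hn0
      simp [hz0r, hz0i, Real.pi_ne_zero, hd.ne', this]
  have hlim : Tendsto (fun J => ‖K * (∑ n ∈ S, T J n *
      Complex.exp (2 * (Real.pi : ℂ) * Complex.I * (θ : ℂ) * (n : ℂ)) / (n : ℂ) ^ (k + 1)) - G‖) atTop
      (𝓝 ‖K * (∑ n ∈ S, riemannZeta (-(k:ℂ) + z0 * n) *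
      Complex.exp (2 * (Real.pi : ℂ) * Complex.I * (θ : ℂ) * (n : ℂ)) / (n : ℂ) ^ (k + 1)) - G‖) := by
    refine Tendsto.norm (Tendsto.sub_const (Tendsto.const_mul _ (tendsto_finsetSum _ fun n hn => ?_)) _)
    exact ((hTt n hn).mul_const _).div_const _
  refine le_of_tendsto hlim ?_
  have hev : ∀ᶠ J : ℕ in atTop, ⌈d * Real.log N⌉ ≤ h0 + J := by
    filter_upwards [eventually_ge_atTop (⌈d * Real.log N⌉ - h0).toNat] with J hJ
    have := Int.self_le_toNat (⌈d * Real.log N⌉ - h0)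
    omega
  filter_upwards [hev] with J hJ
  set β : ℤ → ℂ := fun n => (ascPochhammer ℂ (k+1)).eval (-(k:ℂ) + z0 * n) / (z0 * n) ^ (k+1) with hβd
  have hq := h2 β hβ N hN J hJ
  have hp1 := h1 N
  have key : K * (∑ n ∈ S, T J n *
      Complex.exp (2 * (Real.pi : ℂ) * Complex.I * (θ : ℂ) * (n : ℂ)) / (n : ℂ) ^ (k + 1)) - G =
      K * (a:ℂ) ^ k * (∑ n ∈ S, (-1:ℂ) ^ n * ((-(k:ℂ) + z0 * n) * a / (-(k:ℂ) + z0 * n - 1) +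
        p.eval (-(k:ℂ) + z0 * n)) / (n:ℂ) ^ (k+1)) -
      (d:ℂ) ^ k * Qf β d h0 N J (fun y => (bernoulliFun (k+1) (Int.fract (Real.exp ((y + θ) / d))) : ℂ)) := by
    have hg : G = -((d:ℂ) ^ k * ∑ h ∈ Finset.Ioo (0 : ℤ) ⌈d * Real.log N⌉,
        ((bernoulliFun (k+1) (Int.fract (Real.exp (((h:ℝ) + θ) / d))) : ℝ) : ℂ)) := by
      rw [hG]
      simp only [psiB_pb (show k + 1 ≠ 1 by omega), pb]
      push_cast
      rfl
    have hsum : ∀ n ∈ S, K * (T J n *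
        Complex.exp (2 * (Real.pi : ℂ) * Complex.I * (θ : ℂ) * (n : ℂ)) / (n : ℂ) ^ (k + 1)) =
        K * (a:ℂ) ^ k * ((-1:ℂ) ^ n * ((-(k:ℂ) + z0 * n) * a / (-(k:ℂ) + z0 * n - 1) +
        p.eval (-(k:ℂ) + z0 * n)) / (n:ℂ) ^ (k+1)) -
        (d:ℂ) ^ k * (β n * ∫ y in ((h0:ℝ) + 1/2)..((h0:ℝ) + 1/2 + J), (pb (k+1) (Real.exp ((y + θ) / d)) : ℂ) *
        Complex.exp (Complex.I * ((-(2 * Real.pi * n) * y : ℝ) : ℂ))) := by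
      intro n hn
      have := term_id hk hd θ h0 p J n (Finset.mem_erase.1 hn).1 a ha (-(k:ℂ) + z0 * n) rfl
      rw [← hK] at this
      exact this
    rw [hg, Qf, Finset.mul_sum, Finset.sum_congr rfl hsum, Finset.sum_sub_distrib, ← Finset.mul_sum,
      ← Finset.mul_sum, mul_sub]
    simp only [pb]
    ring
  rw [key]
  refine (norm_sub_le _ _).trans ?_
  rw [norm_mul, norm_mul, norm_mul, norm_pow, norm_pow, Complex.norm_real, Complex.norm_real,
    Real.norm_of_nonneg ha0.le, Real.norm_of_nonneg hd.le]
  have v1 := mul_le_mul_of_nonneg_left hp1 (show 0 ≤ ‖K‖ * a ^ k by positivity)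
  have v2 := mul_le_mul_of_nonneg_left hq (show 0 ≤ d ^ k by positivity)
  have v3 : 0 ≤ ‖K‖ * a ^ k * C1 * Real.log (Real.log N) := by positivity
  nlinarith


end S11

theorem statement4 (k : ℕ) (hk : 0 < k) (d θ : ℝ) (hd : 0 < d) :
    ∃ C > (0 : ℝ), ∃ N₀ : ℕ, ∀ N : ℕ, N₀ ≤ N → 2 ≤ N →
      ‖((Nat.factorial (k + 1) : ℂ) / (2 * (Real.pi : ℂ) * Complex.I) ^ (k + 1)) *
            (∑ n ∈ (Finset.Icc (-(N : ℤ)) (N : ℤ)).erase 0,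
              riemannZeta (-(k : ℂ) + 2 * (Real.pi : ℂ) * Complex.I * (d : ℂ) * (n : ℂ)) *
                Complex.exp (2 * (Real.pi : ℂ) * Complex.I * (θ : ℂ) * (n : ℂ)) /
                  (n : ℂ) ^ (k + 1))
          - ((-(d ^ k * ∑ h ∈ Finset.Ioo (0 : ℤ) ⌈d * Real.log N⌉,
                psiB (k + 1) (Real.exp (((h : ℝ) + θ) / d))) : ℝ) : ℂ)‖
        ≤ C * Real.log (Real.log N) := by
  obtain ⟨C, hC, h⟩ := main_bd k hk d θ hd
  have hl2 : 0 < Real.log 2 := Real.log_pos (by norm_num)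
  refine ⟨C * (1 / Real.log 2 + 1), by positivity, 16, fun N hN _ => (h N hN).trans ?_⟩
  have h16 : (16:ℝ) ≤ N := by exact_mod_cast hN
  have h2 : 2 ≤ Real.log N := by
    have e : Real.log 16 = 4 * Real.log 2 := by
      rw [show (16:ℝ) = 2 ^ 4 by norm_num, Real.log_pow]; norm_num
    have := Real.log_le_log (by norm_num) h16
    have := Real.log_two_gt_d9
    linarith
  have h3 : Real.log 2 ≤ Real.log (Real.log N) := Real.log_le_log (by norm_num) h2
  have h4 : 1 ≤ 1 / Real.log 2 * Real.log (Real.log N) := by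
    rw [one_div, inv_mul_eq_div, le_div_iff₀ hl2]; linarith
  rw [mul_assoc]
  refine mul_le_mul_of_nonneg_left ?_ hC.le
  linarith
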